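/- arXiv:0810.4300 — 5 statements merged into one kernel-verified Lean document; each statement's English description precedes it below -/
import Mathlib

section
/- Strong Rohlin Lemma: Let (X, 𝓑, μ, T) be an ergodic and aperiodic m.t.d.s. and let α be a finite measurable partition of X. Then for every δ > 0 and every n ∈ ℕ there exists a measurable set B ∈ 𝓑 such that B, TB, …, T^{n−1}B are mutually disjoint, μ(⋃_{i=0}^{n−1} T^i B) > 1 − δ, and the partition induced by α on B has the same distribution as α, i.e. μ(A ∩ B) = μ(A)·μ(B) for every atom A of α. -/
open MeasureTheory Filter Topology
open scoped Classical

variable {X : Type*} [MeasurableSpace X]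

noncomputable def cJoin (U V : Finset (Set X)) : Finset (Set X) :=
  (U ×ˢ V).image fun p => p.1 ∩ p.2

noncomputable def preC (S : X → X) (U : Finset (Set X)) : Finset (Set X) :=
  U.image fun A => S ⁻¹' A

noncomputable def joinN (S : X → X) (U : Finset (Set X)) : ℕ → Finset (Set X)
  | 0 => {Set.univ}
  | n + 1 => cJoin (joinN S U n) (preC (S^[n]) U)

def IsMCover (U : Finset (Set X)) : Prop :=
  (∀ A ∈ U, MeasurableSet A) ∧ ⋃₀ (U : Set (Set X)) = Set.univ

def IsMPartition (U : Finset (Set X)) : Prop :=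
  IsMCover U ∧ ∀ A ∈ U, ∀ B ∈ U, A ≠ B → Disjoint A B

def Refines (α U : Finset (Set X)) : Prop := ∀ A ∈ α, ∃ B ∈ U, A ⊆ B

noncomputable def entPart (μ : Measure X) (α : Finset (Set X)) : ℝ :=
  ∑ A ∈ α, Real.negMulLog (μ A).toReal

noncomputable def entCover (μ : Measure X) (U : Finset (Set X)) : ℝ :=
  sInf {h | ∃ α : Finset (Set X), IsMPartition α ∧ Refines α U ∧ h = entPart μ α}

noncomputable def hPart (μ : Measure X) (S : X → X) (α : Finset (Set X)) : ℝ :=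
  limUnder atTop fun n : ℕ => entPart μ (joinN S α n) / n

noncomputable def hPlusC (μ : Measure X) (S : X → X) (U : Finset (Set X)) : ℝ :=
  sInf {h | ∃ α : Finset (Set X), IsMPartition α ∧ Refines α U ∧ h = hPart μ S α}

noncomputable def hMinusC (μ : Measure X) (S : X → X) (U : Finset (Set X)) : ℝ :=
  limUnder atTop fun n : ℕ => entCover μ (joinN S U n) / n

noncomputable def covN (μ : Measure X) (V : Finset (Set X)) (ε : ℝ) : ℕ :=
  sInf {m | ∃ W ⊆ V, W.card = m ∧ 1 - ε < (μ (⋃₀ (W : Set (Set X)))).toReal}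

noncomputable def covNfull (V : Finset (Set X)) : ℕ :=
  sInf {m | ∃ W ⊆ V, W.card = m ∧ ⋃₀ (W : Set (Set X)) = Set.univ}
section Nonatomic

open scoped ENNReal

/-- A finite measure on `ℝ` without atoms takes every intermediate value on a half-line. -/
lemma exists_measure_Iic_eq (ν : Measure ℝ) [IsFiniteMeasure ν] [NullSingletonClass ν]
    {c : ℝ≥0∞} (h0 : c ≠ 0) (hc : c < ν Set.univ) : ∃ t, ν (Set.Iic t) = c := by
  have hint (s : Set ℝ) : IntegrableOn (fun _ => (1 : ℝ)) s ν := (integrable_const _).integrableOn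
  have hcont : Continuous fun t => ν.real (Set.Iic t) := by
    have h := (intervalIntegral.continuous_primitive (μ := ν) (f := fun _ => (1 : ℝ))
      (fun _ _ => ⟨hint _, hint _⟩) 0).add_const (ν.real (Set.Iic 0))
    refine h.congr fun t => ?_
    rw [← intervalIntegral.integral_Iic_sub_Iic (hint _) (hint _)]
    simp
  have hctop : c ≠ ∞ := hc.ne_top
  obtain ⟨b, hb⟩ := ((tendsto_measure_Iic_atTop ν).eventually_const_lt hc).exists
  have hbot : Tendsto (ν ∘ Set.Iic) atBot (𝓝 0) := by
    have h := tendsto_measure_iInter_atBot (μ := ν) (s := Set.Iic)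
      (fun _ => measurableSet_Iic.nullMeasurableSet) monotone_Iic ⟨0, measure_ne_top _ _⟩
    rwa [iInter_Iic_eq_empty_iff.2 (by simp), measure_empty] at h
  obtain ⟨a, ha⟩ := (hbot.eventually_lt_const (pos_iff_ne_zero.2 h0)).exists
  obtain ⟨t, ht⟩ := mem_range_of_exists_le_of_exists_ge hcont (c := c.toReal)
    ⟨a, ENNReal.toReal_mono hctop ha.le⟩
    ⟨b, ENNReal.toReal_mono (measure_ne_top _ _) hb.le⟩
  exact ⟨t, (ENNReal.toReal_eq_toReal_iff' (measure_ne_top _ _) hctop).1 ht⟩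

lemma exists_measurable_subset_measure_eq {X : Type*} [MeasurableSpace X] [StandardBorelSpace X]
    (μ : Measure X) [IsFiniteMeasure μ] [NullSingletonClass μ] {E : Set X} (hE : MeasurableSet E)
    {c : ℝ≥0∞} (hc : c ≤ μ E) : ∃ F ⊆ E, MeasurableSet F ∧ μ F = c := by
  rcases eq_or_ne c 0 with rfl | h0
  · exact ⟨∅, Set.empty_subset _, .empty, measure_empty⟩
  rcases hc.eq_or_lt with rfl | hc
  · exact ⟨E, subset_rfl, hE, rfl⟩
  have hg := measurableEmbedding_embeddingReal X
  have : NullSingletonClass ((μ.restrict E).map (embeddingReal X)) := by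
    refine ⟨fun t => ?_⟩
    rw [hg.map_apply]
    exact (Set.subsingleton_singleton.preimage hg.injective).measure_zero _
  obtain ⟨t, ht⟩ := exists_measure_Iic_eq ((μ.restrict E).map (embeddingReal X)) h0
    (by rwa [hg.map_apply, Set.preimage_univ, Measure.restrict_apply_univ])
  refine ⟨embeddingReal X ⁻¹' Set.Iic t ∩ E, Set.inter_subset_right,
    (hg.measurable measurableSet_Iic).inter hE, ?_⟩
  rwa [hg.map_apply, Measure.restrict_apply (hg.measurable measurableSet_Iic)] at ht

lemma exists_measurable_nat_fibers_measure_eq {X : Type*} [MeasurableSpace X]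
    [StandardBorelSpace X] (μ : Measure X) [IsFiniteMeasure μ] [NullSingletonClass μ] (n : ℕ)
    (c : ℝ≥0∞) (hc : n * c ≤ μ Set.univ) :
    ∃ f : X → ℕ, Measurable f ∧ ∀ j < n, μ (f ⁻¹' {j}) = c := by
  induction n with
  | zero => exact ⟨fun _ => 0, measurable_const, by simp⟩
  | succ n ih =>
    push_cast at hc
    obtain ⟨f, hf, hfc⟩ := ih ((by gcongr; simp : (n : ℝ≥0∞) * c ≤ (n + 1) * c).trans hc)
    have hlt : μ (f ⁻¹' Set.Iio n) ≤ n * c := by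
      have : f ⁻¹' Set.Iio n = ⋃ j ∈ Finset.range n, f ⁻¹' {j} := by ext x; simp
      rw [this]
      refine (measure_biUnion_finset_le _ _).trans ?_
      rw [Finset.sum_congr rfl fun j hj => hfc j (Finset.mem_range.1 hj)]
      simp
    have hcE : c ≤ μ (f ⁻¹' Set.Ici n) := by
      have hctop : n * c ≠ ∞ := by
        refine ne_top_of_le_ne_top (measure_ne_top μ Set.univ) (le_trans ?_ hc)
        gcongr; simp
      refine (ENNReal.add_le_add_iff_left hctop).1 ?_
      calc n * c + c = (n + 1) * c := by ring
        _ ≤ μ Set.univ := hc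
        _ ≤ μ (f ⁻¹' Set.Iio n) + μ (f ⁻¹' Set.Ici n) := by
          rw [← Set.compl_Iio, Set.preimage_compl]
          exact measure_univ_le_add_compl _
        _ ≤ _ := by gcongr
    obtain ⟨F, hFE, hF, hFc⟩ := exists_measurable_subset_measure_eq μ (hf measurableSet_Ici) hcE
    refine ⟨fun x => if x ∈ F then n else if f x = n then n + 1 else f x,
      Measurable.ite hF measurable_const
        (Measurable.ite (hf (measurableSet_singleton n)) measurable_const hf), fun j hj => ?_⟩
    rcases Nat.lt_succ_iff_lt_or_eq.1 hj with hj | rfl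
    · rw [← hfc j hj]
      congr 1
      ext x
      have := @hFE x
      simp only [Set.mem_preimage, Set.mem_Ici, Set.mem_singleton_iff] at this ⊢
      grind
    · rw [← hFc]
      congr 1
      ext x
      simp only [Set.mem_preimage, Set.mem_singleton_iff]
      grind

/-- Finitely many measurable sets can be simultaneously split into `n` parts of equal measure. -/
lemma exists_measurable_nat_fibers_equidistributed {X ι : Type*} [MeasurableSpace X]
    [StandardBorelSpace X] (s : Finset ι) (P : ι → Set X) (hP : ∀ i ∈ s, MeasurableSet (P i))
    {n : ℕ} (hn : n ≠ 0) (μ : Measure X) [IsFiniteMeasure μ] [NullSingletonClass μ] :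
    ∃ f : X → ℕ, Measurable f ∧ (∀ j < n, n * μ (f ⁻¹' {j}) = μ Set.univ) ∧
      ∀ i ∈ s, ∀ j < n, n * μ (P i ∩ f ⁻¹' {j}) = μ (P i) := by
  induction s using Finset.induction_on generalizing μ with
  | empty =>
    have hdiv : n * (μ Set.univ / n) = μ Set.univ :=
      ENNReal.mul_div_cancel (by exact_mod_cast hn) (ENNReal.natCast_ne_top n)
    obtain ⟨f, hf, hfc⟩ := exists_measurable_nat_fibers_measure_eq μ n _ hdiv.le
    exact ⟨f, hf, fun j hj => by rw [hfc j hj, hdiv], by simp⟩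
  | insert a s _ ih =>
    have hPa : MeasurableSet (P a) := hP a (Finset.mem_insert_self _ _)
    have hPs : ∀ i ∈ s, MeasurableSet (P i) := fun i hi => hP i (Finset.mem_insert_of_mem hi)
    obtain ⟨f, hf, hf1, hf2⟩ := ih hPs (μ.restrict (P a))
    obtain ⟨g, hg, hg1, hg2⟩ := ih hPs (μ.restrict (P a)ᶜ)
    have hin (j : ℕ) (Q : Set X) : μ ((Q ∩ (P a).piecewise f g ⁻¹' {j}) ∩ P a) =
        μ.restrict (P a) (Q ∩ f ⁻¹' {j}) := by
      rw [Measure.restrict_apply' hPa]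
      congr 1
      ext x
      simp only [Set.mem_inter_iff, Set.mem_preimage, Set.piecewise]
      grind
    have hout (j : ℕ) (Q : Set X) : μ ((Q ∩ (P a).piecewise f g ⁻¹' {j}) \ P a) =
        μ.restrict (P a)ᶜ (Q ∩ g ⁻¹' {j}) := by
      rw [Measure.restrict_apply' hPa.compl]
      congr 1
      ext x
      simp only [Set.mem_inter_iff, Set.mem_preimage, Set.piecewise, Set.mem_sdiff,
        Set.mem_compl_iff]
      grind
    have hsplit (j : ℕ) (Q : Set X) : μ (Q ∩ (P a).piecewise f g ⁻¹' {j}) =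
        μ.restrict (P a) (Q ∩ f ⁻¹' {j}) + μ.restrict (P a)ᶜ (Q ∩ g ⁻¹' {j}) := by
      rw [← hin, ← hout, measure_inter_add_sdiff _ hPa]
    refine ⟨(P a).piecewise f g, hf.piecewise hPa hg, fun j hj => ?_, fun i hi j hj => ?_⟩
    · have := hsplit j Set.univ
      simp only [Set.univ_inter] at this
      rw [this, mul_add, hf1 j hj, hg1 j hj, Measure.restrict_apply_univ,
        Measure.restrict_apply_univ, measure_add_measure_compl hPa]
    · rcases Finset.mem_insert.1 hi with rfl | hi
      · rw [← hf1 j hj |>.trans (Measure.restrict_apply_univ _), hsplit,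
          Measure.restrict_apply' hPa, Measure.restrict_apply' hPa,
          Measure.restrict_apply' hPa.compl]
        congr 1
        rw [Set.inter_right_comm, Set.inter_right_comm (P i) (g ⁻¹' {j})]
        simp [Set.inter_comm]
      · rw [hsplit, mul_add, hf2 i hi j hj, hg2 i hi j hj, Measure.restrict_apply' hPa,
          Measure.restrict_apply' hPa.compl, ← Set.sdiff_eq, measure_inter_add_sdiff _ hPa]

end Nonatomic

section Rohlin

open scoped ENNReal

variable {X : Type*} [MeasurableSpace X] {μ : Measure X}

lemma nullSingletonClass_of_aperiodic [MeasurableSingletonClass X] [IsFiniteMeasure μ] {T : X → X}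
    (hT : MeasurePreserving T μ μ) (haper : ∀ n : ℕ, 1 ≤ n → μ {x | T^[n] x = x} = 0) :
    NullSingletonClass μ := by
  refine ⟨fun x => ?_⟩
  by_contra hx
  obtain ⟨y, rfl, m, hm, hmy⟩ :=
    hT.exists_mem_iterate_mem (measurableSet_singleton x).nullMeasurableSet hx
  exact hx (measure_mono_null (t := {x | T^[m] x = x}) (Set.singleton_subset_iff.2 hmy)
    (haper m (Nat.one_le_iff_ne_zero.2 hm)))

lemma Ergodic.measure_compl_iUnion_preimage_iterate_eq_zero [IsFiniteMeasure μ] {T : X → X}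
    (hT : Ergodic T μ) {E : Set X} (hE : MeasurableSet E) (hE0 : μ E ≠ 0) :
    μ (⋃ k : ℕ, T^[k] ⁻¹' E)ᶜ = 0 := by
  have hZ : MeasurableSet (⋃ k : ℕ, T^[k] ⁻¹' E) :=
    .iUnion fun k => (hT.measurable.iterate k) hE
  have hsub : T ⁻¹' (⋃ k : ℕ, T^[k] ⁻¹' E) ⊆ ⋃ k : ℕ, T^[k] ⁻¹' E := by
    intro x hx
    simp only [Set.mem_preimage, Set.mem_iUnion] at hx ⊢
    obtain ⟨k, hk⟩ := hx
    exact ⟨k + 1, by rwa [Function.iterate_succ_apply]⟩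
  rcases hT.ae_empty_or_univ_of_preimage_ae_le hZ.nullMeasurableSet hsub.eventuallyLE with h | h
  · exact absurd (measure_mono_null (Set.subset_iUnion (fun k : ℕ => T^[k] ⁻¹' E) 0)
      (ae_eq_empty.1 h)) hE0
  · exact ae_eq_univ.1 h

/-- The points whose first visit to `E` under the iterates of `T` happens at time `k`. -/
def firstHit {Y : Type*} (T : Y → Y) (E : Set Y) (k : ℕ) : Set Y :=
  {x | T^[k] x ∈ E ∧ ∀ l < k, T^[l] x ∉ E}

lemma measurableSet_firstHit {T : X → X} (hT : Measurable T) {E : Set X} (hE : MeasurableSet E)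
    (k : ℕ) : MeasurableSet (firstHit T E k) := by
  have : firstHit T E k = T^[k] ⁻¹' E ∩ ⋂ l ∈ Finset.range k, (T^[l] ⁻¹' E)ᶜ := by
    ext x; simp [firstHit]
  rw [this]
  exact ((hT.iterate k) hE).inter
    (Finset.measurableSet_biInter _ fun l _ => ((hT.iterate l) hE).compl)

lemma eq_of_mem_firstHit {Y : Type*} {T : Y → Y} {E : Set Y} {k l : ℕ} {x : Y}
    (hk : x ∈ firstHit T E k) (hl : x ∈ firstHit T E l) : k = l := by
  rcases lt_trichotomy k l with h | h | h
  · exact absurd hk.1 (hl.2 k h)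
  · exact h
  · exact absurd hl.1 (hk.2 l h)

lemma iterate_mem_firstHit {Y : Type*} {T : Y → Y} {E : Set Y} {k i : ℕ} {x : Y}
    (h : x ∈ firstHit T E (k + i)) : T^[i] x ∈ firstHit T E k := by
  refine ⟨?_, fun l hl => ?_⟩
  · rw [← Function.iterate_add_apply]; exact h.1
  · rw [← Function.iterate_add_apply]; exact h.2 _ (by omega)

lemma mem_firstHit_add {Y : Type*} {T : Y → Y} {E : Set Y} {k i : ℕ} {x : Y}
    (h : T^[i] x ∈ firstHit T E k) (hx : ∀ l < i, T^[l] x ∉ E) : x ∈ firstHit T E (k + i) := by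
  refine ⟨by rw [Function.iterate_add_apply]; exact h.1, fun l hl => ?_⟩
  rcases lt_or_ge l i with hli | hli
  · exact hx l hli
  · obtain ⟨m, rfl⟩ := Nat.exists_eq_add_of_le' hli
    rw [Function.iterate_add_apply]
    exact h.2 m (by omega)

/-- **Rohlin lemma** for ergodic transformations of atomless standard Borel spaces. -/
lemma exists_rohlin_tower [StandardBorelSpace X] [IsProbabilityMeasure μ] [NullSingletonClass μ]
    (T : X ≃ᵐ X) (hT : Ergodic T μ) {N : ℕ} (hN : N ≠ 0) {ε : ℝ≥0∞} (hε : ε ≠ 0) :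
    ∃ C : Set X, MeasurableSet C ∧
      (∀ i < N, ∀ j < N, i ≠ j → Disjoint (T.symm^[i] ⁻¹' C) (T.symm^[j] ⁻¹' C)) ∧
      μ (⋃ i ∈ Finset.range N, T.symm^[i] ⁻¹' C)ᶜ ≤ ε := by
  have hinv (i : ℕ) (x : X) : T^[i] (T.symm^[i] x) = x :=
    Function.RightInverse.iterate T.apply_symm_apply i x
  obtain ⟨E, -, hE, hEc⟩ := exists_measurable_subset_measure_eq μ .univ
    (c := min 1 (ε / N)) (by simp)
  have hE0 : μ E ≠ 0 := by
    rw [hEc]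
    exact (lt_min one_pos (ENNReal.div_pos hε (ENNReal.natCast_ne_top N))).ne'
  have hNE : N * μ E ≤ ε := by
    rw [hEc]
    calc (N : ℝ≥0∞) * min 1 (ε / N) ≤ N * (ε / N) := by gcongr; exact min_le_right _ _
      _ ≤ ε := ENNReal.mul_div_le
  refine ⟨⋃ q : ℕ, firstHit T E (q * N + (N - 1)),
    .iUnion fun q => measurableSet_firstHit T.measurable hE _, fun i hi j hj hij => ?_, ?_⟩
  · refine Set.disjoint_left.2 fun x hxi hxj => hij ?_
    simp only [Set.mem_preimage, Set.mem_iUnion] at hxi hxj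
    obtain ⟨p, hp⟩ := hxi
    obtain ⟨q, hq⟩ := hxj
    have key (r l : ℕ) (hl : l < N) (h : T.symm^[l] x ∈ firstHit T E (r * N + (N - 1))) :
        x ∈ firstHit T E (N - 1 - l + N * r) := by
      rw [show r * N + (N - 1) = (N - 1 - l + N * r) + l by rw [mul_comm]; omega] at h
      simpa only [hinv] using iterate_mem_firstHit h
    have h := congrArg (· % N) (eq_of_mem_firstHit (key p i hi hp) (key q j hj hq))
    simp only [Nat.add_mul_mod_self_left] at h
    rw [Nat.mod_eq_of_lt (by omega), Nat.mod_eq_of_lt (by omega)] at h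
    omega
  · have hsub : (⋃ i ∈ Finset.range N, T.symm^[i] ⁻¹' ⋃ q : ℕ, firstHit T E (q * N + (N - 1)))ᶜ ⊆
        (⋃ k : ℕ, T^[k] ⁻¹' E)ᶜ ∪ ⋃ l ∈ Finset.range N, T.symm^[l] ⁻¹' E := by
      intro x hx
      by_contra hcon
      simp only [Set.mem_union, Set.mem_compl_iff, not_or, Set.mem_iUnion,
        Set.mem_preimage, Finset.mem_range, exists_prop, not_exists, not_and] at hcon hx
      obtain ⟨hk, hback⟩ := hcon
      rw [not_forall_not] at hk
      have hmem : x ∈ firstHit T E (Nat.find hk) :=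
        ⟨Nat.find_spec hk, fun l hl => Nat.find_min hk hl⟩
      set k := Nat.find hk
      have hmod : k % N < N := Nat.mod_lt _ (by omega)
      refine hx (N - 1 - k % N) (by omega) (k / N) ?_
      have hdm := Nat.div_add_mod' k N
      rw [show k / N * N + (N - 1) = k + (N - 1 - k % N) by omega]
      refine mem_firstHit_add (by rwa [hinv]) fun l hl => ?_
      have : T^[l] (T.symm^[N - 1 - k % N] x) = T.symm^[N - 1 - k % N - l] x := by
        obtain ⟨m, hm⟩ := Nat.exists_eq_add_of_le hl.le
        rw [hm, Function.iterate_add_apply, hinv, Nat.add_sub_cancel_left]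
      rw [this]
      exact hback _ (by omega)
    refine (measure_mono hsub).trans ((measure_union_le _ _).trans ?_)
    rw [hT.measure_compl_iUnion_preimage_iterate_eq_zero hE hE0, zero_add]
    refine (measure_biUnion_finset_le _ _).trans ?_
    rw [Finset.sum_congr rfl fun l _ =>
      (hT.symm.toMeasurePreserving.iterate l).measure_preimage hE.nullMeasurableSet]
    simpa using hNE

/-- A Rohlin base of height `n` occupying, up to `η`, the proportion `1 / n` of every set of a
given finite family. -/
lemma exists_equidistributed_rohlin_base [StandardBorelSpace X] [IsProbabilityMeasure μ]
    [NullSingletonClass μ] (T : X ≃ᵐ X) (hT : Ergodic T μ) (α : Finset (Set X))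
    (hα : ∀ A ∈ α, MeasurableSet A) {n : ℕ} (hn : n ≠ 0) {η : ℝ≥0∞} (hη : η ≠ 0) :
    ∃ B : Set X, MeasurableSet B ∧
      (∀ i < n, ∀ j < n, i ≠ j → Disjoint (T.symm^[i] ⁻¹' B) (T.symm^[j] ⁻¹' B)) ∧
      ∀ A ∈ α, μ A ≤ n * μ (A ∩ B) + η := by
  have hinv (i : ℕ) (x : X) : T.symm^[i] (T^[i] x) = x :=
    Function.RightInverse.iterate T.symm_apply_apply i x
  have hη2 : η / 2 ≠ 0 := (ENNReal.half_pos hη).ne'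
  obtain ⟨M, hM⟩ := ENNReal.exists_inv_nat_lt hη2
  have hM0 : M ≠ 0 := by rintro rfl; simp at hM
  have hS (m : ℕ) : MeasurePreserving T.symm^[m] μ μ := hT.symm.toMeasurePreserving.iterate m
  obtain ⟨C, hC, hCd, hCε⟩ := exists_rohlin_tower T hT (mul_ne_zero hn hM0) hη2
  obtain ⟨f, hf, -, hfP⟩ := exists_measurable_nat_fibers_equidistributed
    (α ×ˢ Finset.range (n * M)) (fun p => T^[p.2] ⁻¹' p.1 ∩ C)
    (fun p hp => ((T.measurable.iterate _) (hα _ (Finset.mem_product.1 hp).1)).inter hC) hn μ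
  have hD (j : ℕ) : MeasurableSet (C ∩ f ⁻¹' {j}) := hC.inter (hf (measurableSet_singleton j))
  have hL : n * (M - 1) + n = n * M := by
    obtain ⟨M, rfl⟩ := Nat.exists_eq_succ_of_ne_zero hM0
    simp [Nat.mul_succ]
  set L := n * (M - 1)
  set D : ℕ → Set X := fun m => T.symm^[m] ⁻¹' (C ∩ f ⁻¹' {m % n}) with hDdef
  have hDm (m : ℕ) : MeasurableSet (D m) := (hS m).measurable (hD _)
  have hpull (A Q : Set X) (hA : MeasurableSet A) (hQ : MeasurableSet Q) (m : ℕ) :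
      μ (A ∩ T.symm^[m] ⁻¹' Q) = μ (T^[m] ⁻¹' A ∩ Q) := by
    rw [← (hT.toMeasurePreserving.iterate m).measure_preimage
      (hA.inter ((hS m).measurable hQ)).nullMeasurableSet]
    congr 1
    ext x
    simp [hinv]
  have hDA (A : Set X) (hA : A ∈ α) (m : ℕ) (hm : m < n * M) :
      n * μ (A ∩ D m) = μ (A ∩ T.symm^[m] ⁻¹' C) := by
    rw [hpull A _ (hα A hA) (hD _), hpull A _ (hα A hA) hC, ← Set.inter_assoc]
    exact hfP (A, m) (by simp [hA, hm]) _ (Nat.mod_lt _ (by omega))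
  refine ⟨⋃ m ∈ Finset.range L, D m, Finset.measurableSet_biUnion _ fun m _ => hDm m,
    fun i hi j hj hij => ?_, fun A hA => ?_⟩
  · refine Set.disjoint_left.2 fun x hxi hxj => hij ?_
    simp only [hDdef, Set.mem_preimage, Set.mem_iUnion, Finset.mem_range, exists_prop,
      ← Function.iterate_add_apply] at hxi hxj
    obtain ⟨p, hp, hpC, hpf⟩ := hxi
    obtain ⟨q, hq, hqC, hqf⟩ := hxj
    have hpq : p + i = q + j := by
      by_contra hne
      exact Set.disjoint_left.1 (hCd (p + i) (by omega) (q + j) (by omega) hne) hpC hqC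
    simp only [Set.mem_preimage, Set.mem_singleton_iff] at hpf hqf
    rw [hpq, hqf] at hpf
    have h : q + j ≡ q + i [MOD n] := by
      rw [← hpq]
      exact Nat.ModEq.add_right i hpf.symm
    have h := Nat.ModEq.add_left_cancel' q h
    rw [Nat.ModEq, Nat.mod_eq_of_lt hi, Nat.mod_eq_of_lt hj] at h
    exact h.symm
  · have hdisj : (Finset.range L : Set ℕ).PairwiseDisjoint fun m => A ∩ D m := by
      intro p hp q hq hpq
      simp only [Finset.coe_range, Set.mem_Iio] at hp hq
      refine (hCd p (by omega) q (by omega) hpq).mono ?_ ?_ <;>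
        exact Set.inter_subset_right.trans (Set.preimage_mono Set.inter_subset_left)
    have hAB : n * μ (A ∩ ⋃ m ∈ Finset.range L, D m) =
        ∑ m ∈ Finset.range L, μ (A ∩ T.symm^[m] ⁻¹' C) := by
      rw [Set.inter_iUnion₂, measure_biUnion_finset hdisj fun m _ => (hα A hA).inter (hDm m),
        Finset.mul_sum]
      exact Finset.sum_congr rfl fun m hm => hDA A hA m (by have := Finset.mem_range.1 hm; omega)
    have hCM : n * μ C ≤ η / 2 := by
      have hNC : (n * M : ℕ) * μ C ≤ 1 := by
        have h : μ (⋃ i ∈ Finset.range (n * M), T.symm^[i] ⁻¹' C) = (n * M : ℕ) * μ C := by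
          rw [measure_biUnion_finset _ fun i _ => (hS i).measurable hC,
            Finset.sum_congr rfl fun i _ => (hS i).measure_preimage hC.nullMeasurableSet]
          · simp
          · intro p hp q hq hpq
            exact hCd p (by simpa using hp) q (by simpa using hq) hpq
        exact h ▸ prob_le_one
      refine le_trans ?_ hM.le
      rw [ENNReal.le_inv_iff_mul_le]
      refine le_trans (le_of_eq ?_) hNC
      push_cast; ring
    have hcover : A ⊆ ((⋃ m ∈ Finset.range L, A ∩ T.symm^[m] ⁻¹' C) ∪
        ⋃ m ∈ Finset.range n, T.symm^[L + m] ⁻¹' C) ∪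
        (⋃ i ∈ Finset.range (n * M), T.symm^[i] ⁻¹' C)ᶜ := by
      intro x hx
      by_cases hxt : x ∈ ⋃ i ∈ Finset.range (n * M), T.symm^[i] ⁻¹' C
      · left
        simp only [Set.mem_iUnion, Finset.mem_range, exists_prop] at hxt
        obtain ⟨m, hm, hmx⟩ := hxt
        rcases lt_or_ge m L with hml | hml
        · left
          simp only [Set.mem_iUnion, Finset.mem_range, exists_prop]
          exact ⟨m, hml, hx, hmx⟩
        · right
          obtain ⟨l, rfl⟩ := Nat.exists_eq_add_of_le hml
          simp only [Set.mem_iUnion, Finset.mem_range, exists_prop]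
          exact ⟨l, by omega, hmx⟩
      · exact Or.inr hxt
    calc μ A ≤ (∑ m ∈ Finset.range L, μ (A ∩ T.symm^[m] ⁻¹' C) +
          ∑ m ∈ Finset.range n, μ (T.symm^[L + m] ⁻¹' C)) + η / 2 :=
        (measure_mono hcover).trans ((measure_union_le _ _).trans (add_le_add
          ((measure_union_le _ _).trans (add_le_add (measure_biUnion_finset_le _ _)
            (measure_biUnion_finset_le _ _))) hCε))
      _ = n * μ (A ∩ ⋃ m ∈ Finset.range L, D m) + n * μ C + η / 2 := by
        rw [hAB, Finset.sum_congr rfl fun m (_ : m ∈ Finset.range n) =>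
          (hS (L + m)).measure_preimage hC.nullMeasurableSet]
        simp
      _ ≤ n * μ (A ∩ ⋃ m ∈ Finset.range L, D m) + η / 2 + η / 2 := by gcongr
      _ = _ := by rw [add_assoc, ENNReal.add_halves]

end Rohlin

/-- **Strong Rohlin Lemma.** For an ergodic aperiodic m.t.d.s.
`(X, 𝓑, μ, T)`, a finite measurable partition `α`, `δ > 0` and `n ≥ 1`, there is a
measurable set `B` with `B, TB, …, T^(n−1)B` pairwise disjoint,
`μ(⋃_{i<n} T^i B) > 1 − δ`, and `μ(A ∩ B) = μ(A)·μ(B)` for every atom `A` of `α`. -/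
theorem strong_rohlin {X : Type*} [MeasurableSpace X] [StandardBorelSpace X]
    (μ : Measure X) [IsProbabilityMeasure μ] (T : X ≃ᵐ X)
    (herg : Ergodic ⇑T μ)
    (haper : ∀ n : ℕ, 1 ≤ n → μ {x | (⇑T)^[n] x = x} = 0)
    (α : Finset (Set X)) (hα : IsMPartition α)
    (δ : ℝ) (hδ : 0 < δ) (n : ℕ) (hn : 1 ≤ n) :
    ∃ B : Set X, MeasurableSet B ∧
      (∀ i < n, ∀ j < n, i ≠ j → Disjoint ((⇑T)^[i] '' B) ((⇑T)^[j] '' B)) ∧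
      1 - δ < (μ (⋃ i ∈ Finset.range n, (⇑T)^[i] '' B)).toReal ∧
      ∀ A ∈ α, μ (A ∩ B) = μ A * μ B := by
  have himage (i : ℕ) (B : Set X) : T^[i] '' B = T.symm^[i] ⁻¹' B :=
    congrFun (Set.image_eq_preimage_of_inverse (Function.LeftInverse.iterate T.symm_apply_apply i)
      (Function.RightInverse.iterate T.apply_symm_apply i)) B
  simp only [himage]
  have := nullSingletonClass_of_aperiodic herg.toMeasurePreserving haper
  obtain ⟨⟨hmeas, hcover⟩, hdisj⟩ := hα
  have hn0 : n ≠ 0 := by omega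
  have hnE : (n : ENNReal) ≠ 0 := by exact_mod_cast hn0
  set d : ℝ := min δ 1 / 2 with hd
  have hdpos : 0 < d := by positivity
  have hd1 : d < 1 := by have := min_le_right δ 1; linarith
  have hdδ : d < δ := by have := min_le_left δ 1; linarith
  set η : ENNReal := (α.filter fun A => μ A ≠ 0).inf fun A => ENNReal.ofReal d * μ A
  have hη : η ≠ 0 := by
    refine ((Finset.lt_inf_iff ENNReal.zero_lt_top).2 fun A hA => ?_).ne'
    exact ENNReal.mul_pos (by simpa using hdpos) (Finset.mem_filter.1 hA).2
  obtain ⟨B₀, hB₀, hB₀d, hB₀α⟩ := exists_equidistributed_rohlin_base T herg α hmeas hn0 hη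
  set c : ENNReal := (1 - ENNReal.ofReal d) / n with hc
  have hcA : ∀ A ∈ α, c * μ A ≤ μ (A ∩ B₀) := by
    intro A hA
    by_cases hA0 : μ A = 0
    · simp [hA0]
    have hle : η ≤ ENNReal.ofReal d * μ A := Finset.inf_le (Finset.mem_filter.2 ⟨hA, hA0⟩)
    rw [hc, ENNReal.div_eq_inv_mul, mul_assoc, ← ENNReal.div_eq_inv_mul]
    refine ENNReal.div_le_of_le_mul' ?_
    rw [ENNReal.sub_mul (fun _ _ => measure_ne_top _ _), one_mul, tsub_le_iff_right]
    exact (hB₀α A hA).trans (by gcongr)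
  choose! F hFsub hF hFc using fun A hA =>
    exists_measurable_subset_measure_eq μ ((hmeas A hA).inter hB₀) (hcA A hA)
  set B : Set X := ⋃ A ∈ α, F A
  have hB : MeasurableSet B := Finset.measurableSet_biUnion _ hF
  have hBB₀ : B ⊆ B₀ := Set.iUnion₂_subset fun A hA => (hFsub A hA).trans Set.inter_subset_right
  have hBd : ∀ i < n, ∀ j < n, i ≠ j → Disjoint (T.symm^[i] ⁻¹' B) (T.symm^[j] ⁻¹' B) :=
    fun i hi j hj hij =>
      (hB₀d i hi j hj hij).mono (Set.preimage_mono hBB₀) (Set.preimage_mono hBB₀)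
  have hAB : ∀ A ∈ α, μ (A ∩ B) = c * μ A := by
    intro A hA
    rw [← hFc A hA]
    congr 1
    refine Set.Subset.antisymm ?_ fun x hx =>
      ⟨(hFsub A hA hx).1, Set.mem_iUnion₂.2 ⟨A, hA, hx⟩⟩
    rintro x ⟨hxA, hxB⟩
    obtain ⟨A', hA', hx⟩ := Set.mem_iUnion₂.1 hxB
    by_cases h : A = A'
    · rwa [h]
    · exact absurd (hFsub A' hA' hx).1 (Set.disjoint_left.1 (hdisj A hA A' hA' h) hxA)
  have hsum (Q : Set X) (hQ : MeasurableSet Q) : ∑ A ∈ α, μ (A ∩ Q) = μ Q := by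
    rw [← measure_biUnion_finset _ fun A hA => (hmeas A hA).inter hQ]
    · rw [← Set.iUnion₂_inter]
      congr 1
      rw [Set.sUnion_eq_biUnion] at hcover
      simp only [Finset.mem_coe] at hcover
      rw [hcover, Set.univ_inter]
    · intro A hA A' hA' h
      exact (hdisj A hA A' hA' h).mono Set.inter_subset_left Set.inter_subset_left
  have hμB : μ B = c := by
    rw [← hsum B hB, Finset.sum_congr rfl hAB, ← Finset.mul_sum]
    have := hsum Set.univ .univ
    simp only [Set.inter_univ, measure_univ] at this
    rw [this, mul_one]
  refine ⟨B, hB, hBd, ?_, fun A hA => by rw [hAB A hA, hμB, mul_comm]⟩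
  have htower : μ (⋃ i ∈ Finset.range n, T.symm^[i] ⁻¹' B) = 1 - ENNReal.ofReal d := by
    have hS (m : ℕ) : MeasurePreserving T.symm^[m] μ μ := herg.symm.toMeasurePreserving.iterate m
    rw [measure_biUnion_finset _ fun i _ => (hS i).measurable hB,
      Finset.sum_congr rfl fun i _ => (hS i).measure_preimage hB.nullMeasurableSet]
    · rw [hμB, Finset.sum_const, Finset.card_range, nsmul_eq_mul,
        ENNReal.mul_div_cancel hnE (ENNReal.natCast_ne_top n)]
    · intro p hp q hq hpq
      exact hBd p (by simpa using hp) q (by simpa using hq) hpq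
  rw [htower, ← ENNReal.ofReal_one, ← ENNReal.ofReal_sub _ hdpos.le,
    ENNReal.toReal_ofReal (by linarith)]
  linarith
end

section
/- Let (X, 𝓑, μ, T) be an m.t.d.s., 𝓤 a cover of X, and m ∈ ℕ, m ≥ 1. Then h_μ^−(𝓤, T) = (1/m)·h_μ^−(𝓤_0^{m−1}, T^m), where on the right-hand side 𝓤_0^{m−1} (formed using T) is viewed as a cover of the system (X, 𝓑, μ, T^m). -/
open MeasureTheory Filter Topology
open scoped Classical

variable {X : Type*} [MeasurableSpace X]

section Join

variable {Y : Type*}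

lemma mem_cJoin {U V : Finset (Set Y)} {C : Set Y} :
    C ∈ cJoin U V ↔ ∃ A ∈ U, ∃ B ∈ V, A ∩ B = C := by
  simp only [cJoin, Finset.mem_image, Finset.mem_product, Prod.exists]
  tauto

lemma mem_preC {S : Y → Y} {U : Finset (Set Y)} {C : Set Y} :
    C ∈ preC S U ↔ ∃ A ∈ U, S ⁻¹' A = C := by
  simp [preC]

lemma cJoin_assoc (U V W : Finset (Set Y)) :
    cJoin (cJoin U V) W = cJoin U (cJoin V W) := by
  ext C
  simp only [mem_cJoin]
  constructor
  · rintro ⟨_, ⟨A, hA, B, hB, rfl⟩, D, hD, rfl⟩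
    exact ⟨A, hA, _, ⟨B, hB, D, hD, rfl⟩, (Set.inter_assoc _ _ _).symm⟩
  · rintro ⟨A, hA, _, ⟨B, hB, D, hD, rfl⟩, rfl⟩
    exact ⟨_, ⟨A, hA, B, hB, rfl⟩, D, hD, Set.inter_assoc _ _ _⟩

lemma cJoin_univ (U : Finset (Set Y)) : cJoin U {Set.univ} = U := by
  ext C
  simp [mem_cJoin]

lemma preC_univ (S : Y → Y) : preC S {Set.univ} = {Set.univ} := by
  simp [preC]

lemma preC_cJoin (S : Y → Y) (U V : Finset (Set Y)) :
    preC S (cJoin U V) = cJoin (preC S U) (preC S V) := by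
  ext C
  simp only [mem_cJoin, mem_preC]
  constructor
  · rintro ⟨_, ⟨A, hA, B, hB, rfl⟩, rfl⟩
    exact ⟨_, ⟨A, hA, rfl⟩, _, ⟨B, hB, rfl⟩, rfl⟩
  · rintro ⟨_, ⟨A, hA, rfl⟩, _, ⟨B, hB, rfl⟩, rfl⟩
    exact ⟨_, ⟨A, hA, B, hB, rfl⟩, rfl⟩

lemma preC_preC (S R : Y → Y) (U : Finset (Set Y)) :
    preC S (preC R U) = preC (R ∘ S) U := by
  ext C
  simp [mem_preC, Set.preimage_comp]

lemma joinN_add (S : Y → Y) (U : Finset (Set Y)) (a b : ℕ) :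
    joinN S U (a + b) = cJoin (joinN S U a) (preC (S^[a]) (joinN S U b)) := by
  induction b with
  | zero => simp only [add_zero, joinN, preC_univ, cJoin_univ]
  | succ b ih =>
    rw [← add_assoc, joinN, ih, joinN, preC_cJoin, preC_preC, ← Function.iterate_add,
      cJoin_assoc, add_comm b a]

lemma joinN_iterate (S : Y → Y) (U : Finset (Set Y)) (m n : ℕ) :
    joinN (S^[m]) (joinN S U m) n = joinN S U (m * n) := by
  induction n with
  | zero => rfl
  | succ n ih => rw [joinN, ih, Nat.mul_succ, joinN_add, Function.iterate_mul]

lemma Refines.cJoin {α β U V : Finset (Set Y)} (hα : Refines α U) (hβ : Refines β V) :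
    Refines (cJoin α β) (cJoin U V) := by
  intro C hC
  obtain ⟨A, hA, B, hB, rfl⟩ := mem_cJoin.1 hC
  obtain ⟨A', hA', hAA⟩ := hα A hA
  obtain ⟨B', hB', hBB⟩ := hβ B hB
  exact ⟨A' ∩ B', mem_cJoin.2 ⟨A', hA', B', hB', rfl⟩, Set.inter_subset_inter hAA hBB⟩

lemma Refines.preC (S : Y → Y) {α U : Finset (Set Y)} (hα : Refines α U) :
    Refines (preC S α) (preC S U) := by
  intro C hC
  obtain ⟨A, hA, rfl⟩ := mem_preC.1 hC
  obtain ⟨B, hB, hAB⟩ := hα A hA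
  exact ⟨S ⁻¹' B, mem_preC.2 ⟨B, hB, rfl⟩, Set.preimage_mono hAB⟩

end Join

lemma IsMCover.cJoin {U V : Finset (Set X)} (hU : IsMCover U) (hV : IsMCover V) :
    IsMCover (cJoin U V) := by
  refine ⟨fun C hC => ?_, Set.eq_univ_of_forall fun x => ?_⟩
  · obtain ⟨A, hA, B, hB, rfl⟩ := mem_cJoin.1 hC
    exact (hU.1 A hA).inter (hV.1 B hB)
  · obtain ⟨A, hA, hxA⟩ := Set.mem_sUnion.1 (hU.2.symm ▸ Set.mem_univ x)
    obtain ⟨B, hB, hxB⟩ := Set.mem_sUnion.1 (hV.2.symm ▸ Set.mem_univ x)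
    exact ⟨A ∩ B, mem_cJoin.2 ⟨A, hA, B, hB, rfl⟩, hxA, hxB⟩

lemma IsMCover.preC {S : X → X} (hS : Measurable S) {U : Finset (Set X)} (hU : IsMCover U) :
    IsMCover (preC S U) := by
  refine ⟨fun C hC => ?_, Set.eq_univ_of_forall fun x => ?_⟩
  · obtain ⟨A, hA, rfl⟩ := mem_preC.1 hC
    exact hS (hU.1 A hA)
  · obtain ⟨A, hA, hxA⟩ := Set.mem_sUnion.1 (hU.2.symm ▸ Set.mem_univ (S x))
    exact ⟨S ⁻¹' A, mem_preC.2 ⟨A, hA, rfl⟩, hxA⟩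

lemma IsMCover.joinN {S : X → X} (hS : Measurable S) {U : Finset (Set X)} (hU : IsMCover U)
    (n : ℕ) : IsMCover (joinN S U n) := by
  induction n with
  | zero => simp [_root_.joinN, IsMCover]
  | succ n ih => exact ih.cJoin (hU.preC (hS.iterate n))

lemma IsMPartition.cJoin {α β : Finset (Set X)} (hα : IsMPartition α) (hβ : IsMPartition β) :
    IsMPartition (cJoin α β) := by
  refine ⟨hα.1.cJoin hβ.1, fun C hC D hD hne => ?_⟩
  obtain ⟨A, hA, B, hB, rfl⟩ := mem_cJoin.1 hC
  obtain ⟨A', hA', B', hB', rfl⟩ := mem_cJoin.1 hD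
  by_cases hAA : A = A'
  · have hBB : B ≠ B' := fun h => hne (by rw [hAA, h])
    exact (hβ.2 B hB B' hB' hBB).mono Set.inter_subset_right Set.inter_subset_right
  · exact (hα.2 A hA A' hA' hAA).mono Set.inter_subset_left Set.inter_subset_left

lemma IsMPartition.preC {S : X → X} (hS : Measurable S) {α : Finset (Set X)}
    (hα : IsMPartition α) : IsMPartition (preC S α) := by
  refine ⟨hα.1.preC hS, fun C hC D hD hne => ?_⟩
  obtain ⟨A, hA, rfl⟩ := mem_preC.1 hC
  obtain ⟨B, hB, rfl⟩ := mem_preC.1 hD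
  exact (hα.2 A hA B hB fun h => hne (by rw [h])).preimage S

/-- The partition into atoms of the algebra generated by a measurable cover refines it. -/
lemma IsMCover.exists_partition [Nonempty X] {U : Finset (Set X)} (hU : IsMCover U) :
    ∃ α, IsMPartition α ∧ Refines α U := by
  let f : Finset (Set X) → Set X := fun W => {x | ∀ A ∈ U, x ∈ A ↔ A ∈ W}
  have hmem : ∀ x, x ∈ f {A ∈ U | x ∈ A} := fun x A hA => by simp [hA]
  refine ⟨U.powerset.image f, ⟨⟨fun C hC => ?_, Set.eq_univ_of_forall fun x => ?_⟩, ?_⟩, ?_⟩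
  · obtain ⟨W, -, rfl⟩ := Finset.mem_image.1 hC
    have : f W = ⋂ A ∈ U, {x | x ∈ A ↔ A ∈ W} := by
      ext x
      simp [f]
    rw [this]
    refine Finset.measurableSet_biInter _ fun A hA => ?_
    by_cases hAW : A ∈ W
    · simpa [hAW] using hU.1 A hA
    · simp only [hAW, iff_false]
      exact (hU.1 A hA).compl
  · exact ⟨_, Finset.mem_coe.2 <| Finset.mem_image.2
      ⟨{A ∈ U | x ∈ A}, Finset.mem_powerset.2 (Finset.filter_subset _ _), rfl⟩, hmem x⟩
  · intro C hC D hD hne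
    obtain ⟨W, hW, rfl⟩ := Finset.mem_image.1 hC
    obtain ⟨W', hW', rfl⟩ := Finset.mem_image.1 hD
    refine Set.disjoint_left.2 fun x hx hx' => hne ?_
    ext y
    exact forall₂_congr fun A hA => by rw [← hx A hA, ← hx' A hA]
  · intro C hC
    obtain ⟨W, hW, rfl⟩ := Finset.mem_image.1 hC
    rcases W.eq_empty_or_nonempty with rfl | ⟨A, hA⟩
    · obtain ⟨x⟩ := ‹Nonempty X›
      obtain ⟨A, hA, -⟩ := Set.mem_sUnion.1 (hU.2.symm ▸ Set.mem_univ x)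
      refine ⟨A, hA, fun y hy => ?_⟩
      obtain ⟨B, hB, hyB⟩ := Set.mem_sUnion.1 (hU.2.symm ▸ Set.mem_univ y)
      simpa using (hy B hB).1 hyB
    · have hAU := Finset.mem_powerset.1 hW hA
      exact ⟨A, hAU, fun y hy => (hy A hAU).2 hA⟩

/-- Subadditivity of the Shannon entropy for a joint distribution on a finite product. -/
lemma sum_negMulLog_le_add {ι κ : Type*} (s : Finset ι) (t : Finset κ) (p : ι → κ → ℝ)
    (hp : ∀ i ∈ s, ∀ j ∈ t, 0 ≤ p i j) (h1 : ∑ i ∈ s, ∑ j ∈ t, p i j = 1) :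
    ∑ i ∈ s, ∑ j ∈ t, Real.negMulLog (p i j) ≤
      ∑ i ∈ s, Real.negMulLog (∑ j ∈ t, p i j) + ∑ j ∈ t, Real.negMulLog (∑ i ∈ s, p i j) := by
  set r : ι → ℝ := fun i => ∑ j ∈ t, p i j with hr
  have hr0 : ∀ i ∈ s, 0 ≤ r i := fun i hi => Finset.sum_nonneg (hp i hi)
  have hzero : ∀ i ∈ s, r i = 0 → ∀ j ∈ t, p i j = 0 := fun i hi h j hj =>
    (Finset.sum_eq_zero_iff_of_nonneg (hp i hi)).1 h j hj
  have key : ∀ j ∈ t, ∑ i ∈ s, (Real.negMulLog (p i j) + p i j * Real.log (r i)) ≤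
      Real.negMulLog (∑ i ∈ s, p i j) := by
    intro j hj
    have hJ := Real.concaveOn_negMulLog.le_map_sum (t := s) (w := r)
      (p := fun i => p i j / r i) hr0 h1
      (fun i hi => div_nonneg (hp i hi j hj) (hr0 i hi))
    have e1 : ∑ i ∈ s, r i • (p i j / r i) = ∑ i ∈ s, p i j := by
      refine Finset.sum_congr rfl fun i hi => ?_
      by_cases h : r i = 0
      · simp [h, hzero i hi h j hj]
      · rw [smul_eq_mul, mul_div_cancel₀ _ h]
    have e2 : ∑ i ∈ s, r i • Real.negMulLog (p i j / r i) =
        ∑ i ∈ s, (Real.negMulLog (p i j) + p i j * Real.log (r i)) := by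
      refine Finset.sum_congr rfl fun i hi => ?_
      by_cases h' : p i j = 0
      · simp [h']
      · have h : r i ≠ 0 := fun h => h' (hzero i hi h j hj)
        rw [smul_eq_mul, Real.negMulLog, Real.negMulLog, Real.log_div h' h]
        field_simp
        ring
    rwa [e1, e2] at hJ
  have hsum := Finset.sum_le_sum key
  rw [Finset.sum_comm] at hsum
  simp only [Finset.sum_add_distrib, ← Finset.sum_mul] at hsum
  have e3 : ∑ i ∈ s, Real.negMulLog (r i) = -∑ i ∈ s, r i * Real.log (r i) := by
    simp [Real.negMulLog, Finset.sum_neg_distrib]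
  linarith

section Entropy

variable (μ : Measure X) [IsProbabilityMeasure μ]

lemma negMulLog_measure_nonneg (A : Set X) : 0 ≤ Real.negMulLog (μ A).toReal :=
  Real.negMulLog_nonneg ENNReal.toReal_nonneg measureReal_le_one

lemma entPart_nonneg (α : Finset (Set X)) : 0 ≤ entPart μ α :=
  Finset.sum_nonneg fun A _ => negMulLog_measure_nonneg μ A

lemma IsMPartition.sum_measure_inter {α : Finset (Set X)} (hα : IsMPartition α) {B : Set X}
    (hB : MeasurableSet B) : ∑ A ∈ α, (μ (A ∩ B)).toReal = (μ B).toReal := by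
  have h := measureReal_biUnion_finset (μ := μ) (s := α) (f := fun A => A ∩ B)
    (fun A hA A' hA' hne => (hα.2 A hA A' hA' hne).mono Set.inter_subset_left
      Set.inter_subset_left) (fun A hA => (hα.1.1 A hA).inter hB)
  have hu : ⋃ A ∈ α, A ∩ B = B := by
    have := hα.1.2
    rw [Set.sUnion_eq_biUnion] at this
    simp only [Finset.mem_coe] at this
    rw [← Set.iUnion₂_inter, this, Set.univ_inter]
  rw [hu] at h
  exact h.symm

lemma entPart_cJoin_le {α β : Finset (Set X)} (hα : IsMPartition α) (hβ : IsMPartition β) :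
    entPart μ (cJoin α β) ≤ entPart μ α + entPart μ β := by
  have hr : ∀ A ∈ α, ∑ B ∈ β, (μ (A ∩ B)).toReal = (μ A).toReal := fun A hA => by
    simpa only [Set.inter_comm] using hβ.sum_measure_inter μ (hα.1.1 A hA)
  have hc : ∀ B ∈ β, ∑ A ∈ α, (μ (A ∩ B)).toReal = (μ B).toReal := fun B hB =>
    hα.sum_measure_inter μ (hβ.1.1 B hB)
  have h1 : ∑ A ∈ α, ∑ B ∈ β, (μ (A ∩ B)).toReal = 1 := by
    rw [Finset.sum_congr rfl hr]
    simpa using hα.sum_measure_inter μ MeasurableSet.univ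
  have h := sum_negMulLog_le_add α β (fun A B => (μ (A ∩ B)).toReal)
    (fun _ _ _ _ => ENNReal.toReal_nonneg) h1
  rw [Finset.sum_congr rfl fun A hA => congrArg Real.negMulLog (hr A hA),
    Finset.sum_congr rfl fun B hB => congrArg Real.negMulLog (hc B hB)] at h
  refine le_trans ?_ h
  rw [← Finset.sum_product']
  exact Finset.sum_image_le_of_nonneg (f := fun A => Real.negMulLog (μ A).toReal)
    fun A _ => negMulLog_measure_nonneg μ A

variable {μ} in
lemma entPart_preC_le {S : X → X} (hS : MeasurePreserving S μ μ) {α : Finset (Set X)}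
    (hα : IsMPartition α) : entPart μ (preC S α) ≤ entPart μ α := by
  refine (Finset.sum_image_le_of_nonneg (f := fun A => Real.negMulLog (μ A).toReal)
    fun A _ => negMulLog_measure_nonneg μ A).trans_eq ?_
  exact Finset.sum_congr rfl fun A hA => by
    rw [hS.measure_preimage (hα.1.1 A hA).nullMeasurableSet]

lemma entCover_le {α U : Finset (Set X)} (hα : IsMPartition α) (h : Refines α U) :
    entCover μ U ≤ entPart μ α := by
  refine csInf_le ⟨0, ?_⟩ ⟨α, hα, h, rfl⟩
  rintro _ ⟨β, -, -, rfl⟩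
  exact entPart_nonneg μ β

lemma entCover_nonneg (U : Finset (Set X)) : 0 ≤ entCover μ U := by
  refine Real.sInf_nonneg ?_
  rintro _ ⟨β, -, -, rfl⟩
  exact entPart_nonneg μ β

variable {μ} in
lemma IsMCover.le_entCover {U : Finset (Set X)} (hU : IsMCover U) {c : ℝ}
    (h : ∀ α, IsMPartition α → Refines α U → c ≤ entPart μ α) : c ≤ entCover μ U := by
  have : Nonempty X := nonempty_of_isProbabilityMeasure μ
  obtain ⟨α, hα, hαU⟩ := hU.exists_partition
  refine le_csInf ⟨_, α, hα, hαU, rfl⟩ ?_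
  rintro _ ⟨β, hβ, hβU, rfl⟩
  exact h β hβ hβU

lemma entCover_cJoin_le {U V : Finset (Set X)} (hU : IsMCover U) (hV : IsMCover V) :
    entCover μ (cJoin U V) ≤ entCover μ U + entCover μ V := by
  rw [← sub_le_iff_le_add]
  refine hU.le_entCover fun α hα hαU => ?_
  rw [sub_le_comm]
  refine hV.le_entCover fun β hβ hβV => ?_
  rw [sub_le_iff_le_add']
  exact (entCover_le μ (hα.cJoin hβ) (hαU.cJoin hβV)).trans (entPart_cJoin_le μ hα hβ)

variable {μ} in
lemma entCover_preC_le {S : X → X} (hS : MeasurePreserving S μ μ) {U : Finset (Set X)}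
    (hU : IsMCover U) : entCover μ (preC S U) ≤ entCover μ U :=
  hU.le_entCover fun _ hα hαU =>
    (entCover_le μ (hα.preC hS.measurable) (hαU.preC S)).trans (entPart_preC_le hS hα)

variable {μ} in
lemma subadditive_entCover_joinN {S : X → X} (hS : MeasurePreserving S μ μ)
    {U : Finset (Set X)} (hU : IsMCover U) :
    Subadditive fun n => entCover μ (joinN S U n) := by
  intro a b
  have hJ := hU.joinN hS.measurable
  dsimp only
  rw [joinN_add]
  exact (entCover_cJoin_le μ (hJ a) ((hJ b).preC (hS.iterate a).measurable)).trans
    (add_le_add_right (entCover_preC_le (hS.iterate a) (hJ b)) _)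

variable {μ} in
lemma tendsto_hMinusC {S : X → X} (hS : MeasurePreserving S μ μ)
    {U : Finset (Set X)} (hU : IsMCover U) :
    Tendsto (fun n : ℕ => entCover μ (joinN S U n) / n) atTop (𝓝 (hMinusC μ S U)) := by
  refine tendsto_nhds_limUnder ⟨_, (subadditive_entCover_joinN hS hU).tendsto_lim ⟨0, ?_⟩⟩
  rintro _ ⟨n, rfl⟩
  exact div_nonneg (entCover_nonneg μ _) n.cast_nonneg

end Entropy

/-- For an m.t.d.s. `(X, 𝓑, μ, T)`, a cover `𝓤` and `m ≥ 1`,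
`h_μ⁻(𝓤, T) = (1/m)·h_μ⁻(𝓤₀^{m−1}, Tᵐ)`. -/
theorem hMinus_power {X : Type*} [MeasurableSpace X] [StandardBorelSpace X]
    (μ : Measure X) [IsProbabilityMeasure μ] (T : X ≃ᵐ X)
    (hT : MeasurePreserving ⇑T μ μ)
    (U : Finset (Set X)) (hU : IsMCover U) (m : ℕ) (hm : 1 ≤ m) :
    hMinusC μ ⇑T U = (1 / (m : ℝ)) * hMinusC μ ((⇑T)^[m]) (joinN ⇑T U m) := by
  have hm0 : (m : ℝ) ≠ 0 := by positivity
  have h := ((tendsto_hMinusC hT hU).comp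
    (tendsto_id.const_mul_atTop' (show 0 < m by omega))).const_mul (m : ℝ)
  have h' : Tendsto (fun n : ℕ => entCover μ (joinN ((⇑T)^[m]) (joinN (⇑T) U m) n) / n) atTop
      (𝓝 (m * hMinusC μ (⇑T) U)) := by
    refine h.congr fun n => ?_
    simp only [Function.comp_apply, id, joinN_iterate, Nat.cast_mul]
    rw [mul_div_assoc', mul_div_mul_left _ _ hm0]
  rw [hMinusC.eq_def μ ((⇑T)^[m]), h'.limUnder_eq, ← mul_assoc, one_div_mul_cancel hm0, one_mul]
end

section
/- Let (X, 𝓑, μ, T) be an ergodic m.t.d.s., α a finite measurable partition of X, and 0 < ε < 1. Then h_μ(α, T) = lim_{n→∞} (1/n)·log 𝓝(α_0^{n−1}, ε), where 𝓝(α_0^{n−1}, ε) is the minimal number of atoms of α_0^{n−1} whose union has μ-measure greater than 1 − ε. -/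
open MeasureTheory Filter Topology
open scoped Classical

variable {X : Type*} [MeasurableSpace X]

theorem integral_comp_measurePreserving {μ : Measure X} {T : X → X}
    (hT : MeasurePreserving T μ μ) {f : X → ℝ} (hf : Measurable f) :
    ∫ x, f (T x) ∂μ = ∫ x, f x ∂μ := by
  conv_rhs => rw [← hT.map_eq]
  exact (integral_map hT.measurable.aemeasurable hf.aestronglyMeasurable).symm

theorem integrable_of_abs_le {μ : Measure X} [IsFiniteMeasure μ] {f : X → ℝ}
    (hf : Measurable f) {M : ℝ} (hM : ∀ x, |f x| ≤ M) : Integrable f μ :=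
  Integrable.of_bound hf.aestronglyMeasurable M (ae_of_all _ hM)

theorem measurable_birkhoffSum {T : X → X} (hT : Measurable T) {f : X → ℝ} (hf : Measurable f)
    (n : ℕ) : Measurable (birkhoffSum T f n) :=
  Finset.measurable_fun_sum _ fun i _ => hf.comp (hT.iterate i)

theorem abs_birkhoffSum_le {X : Type*} {T : X → X} {f : X → ℝ} {M : ℝ} (hM : ∀ x, |f x| ≤ M)
    (n : ℕ) (x : X) :
    |birkhoffSum T f n x| ≤ n * M := by
  refine (Finset.abs_sum_le_sum_abs _ _).trans ?_
  simpa using Finset.sum_le_sum (s := Finset.range n) fun i _ => hM (T^[i] x)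

theorem integral_birkhoffSum {μ : Measure X} [IsFiniteMeasure μ] {T : X → X}
    (hT : MeasurePreserving T μ μ) {f : X → ℝ} (hf : Measurable f) {M : ℝ} (hM : ∀ x, |f x| ≤ M)
    (n : ℕ) : ∫ x, birkhoffSum T f n x ∂μ = n * ∫ x, f x ∂μ := by
  simp only [birkhoffSum]
  rw [integral_finsetSum]
  · simp [integral_comp_measurePreserving (hT.iterate _) hf]
  · exact fun i _ => integrable_of_abs_le (hf.comp (hT.iterate i).measurable) fun x => hM _

theorem integral_abs_le_norm_Lp {μ : Measure X} [IsProbabilityMeasure μ] (F : Lp ℝ 2 μ) :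
    ∫ x, |F x| ∂μ ≤ ‖F‖ := by
  have h1 : ∫ x, |F x| ∂μ = (eLpNorm F 1 μ).toReal := by
    rw [eLpNorm_one_eq_lintegral_enorm, ← integral_norm_eq_lintegral_enorm
      (Lp.aestronglyMeasurable F)]
    rfl
  rw [h1, Lp.norm_def]
  exact ENNReal.toReal_mono (Lp.eLpNorm_ne_top F)
    (eLpNorm_le_eLpNorm_of_exponent_le (by norm_num) (Lp.aestronglyMeasurable F))

/-- The mean ergodic theorem in `L¹` for bounded functions. -/
theorem Ergodic.tendsto_integral_abs_birkhoffSum_div {μ : Measure X} [IsProbabilityMeasure μ]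
    {T : X → X} (hT : Ergodic T μ) {f : X → ℝ} (hf : Measurable f) {M : ℝ}
    (hM : ∀ x, |f x| ≤ M) :
    Tendsto (fun n : ℕ => ∫ x, |birkhoffSum T f n x / n - ∫ y, f y ∂μ| ∂μ) atTop (𝓝 0) := by
  have hTm := hT.toMeasurePreserving
  let U : Lp ℝ 2 μ →L[ℝ] Lp ℝ 2 μ :=
    (Lp.compMeasurePreservingₗᵢ ℝ T hTm).toContinuousLinearMap
  have hmem : ∀ n, MemLp (birkhoffSum T f n) 2 μ := fun n =>
    MemLp.of_bound (measurable_birkhoffSum hT.measurable hf n).aestronglyMeasurable (n * M)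
      (ae_of_all _ (abs_birkhoffSum_le hM n))
  have hmem' : MemLp f 2 μ := MemLp.of_bound hf.aestronglyMeasurable M (ae_of_all _ hM)
  have hit : ∀ i, U^[i] (hmem'.toLp f) =
      (hmem'.comp_measurePreserving (hTm.iterate i)).toLp (f ∘ T^[i]) := by
    intro i
    induction i with
    | zero => rfl
    | succ i ih =>
      rw [Function.iterate_succ_apply', ih]
      exact Lp.toLp_compMeasurePreserving _ hTm
  have hsum : ∀ n, birkhoffSum U _root_.id n (hmem'.toLp f) = (hmem n).toLp _ := by
    intro n
    induction n with
    | zero =>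
      rw [birkhoffSum_zero]
      exact (MemLp.toLp_zero (hmem 0)).symm
    | succ n ih =>
      rw [birkhoffSum_succ, ih, id, hit, ← MemLp.toLp_add]
      congr 1
      ext x
      simp [birkhoffSum_succ]
  have hlim := U.tendsto_birkhoffAverage_orthogonalProjection
    (LinearIsometry.norm_toContinuousLinearMap_le _) (hmem'.toLp f)
  set g := (U.eqLocus (1 : Lp ℝ 2 μ →L[ℝ] Lp ℝ 2 μ)).orthogonalProjectionOnto (hmem'.toLp f)
  have hg : U (g : Lp ℝ 2 μ) = g := g.2
  obtain ⟨c, hc⟩ : ∃ c : ℝ, (g : Lp ℝ 2 μ) =ᵐ[μ] fun _ => c := by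
    have h1 : ((g : Lp ℝ 2 μ) : X → ℝ) ∘ T =ᵐ[μ] (g : Lp ℝ 2 μ) :=
      (Lp.coeFn_compMeasurePreserving (g : Lp ℝ 2 μ) hTm).symm.trans
        (by rw [show Lp.compMeasurePreserving T hTm (g : Lp ℝ 2 μ) = g from hg])
    exact hT.ae_eq_const_of_ae_eq_comp₀ (Lp.aestronglyMeasurable _).aemeasurable.nullMeasurable h1
  have hle : ∀ n : ℕ, ∫ x, |birkhoffSum T f n x / n - c| ∂μ ≤
      ‖birkhoffAverage ℝ U _root_.id n (hmem'.toLp f) - g‖ := by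
    intro n
    refine le_trans (le_of_eq ?_) (integral_abs_le_norm_Lp _)
    refine integral_congr_ae ?_
    rw [birkhoffAverage, hsum]
    filter_upwards [hc, Lp.coeFn_sub ((n : ℝ)⁻¹ • (hmem n).toLp _) (g : Lp ℝ 2 μ),
      Lp.coeFn_smul (n : ℝ)⁻¹ ((hmem n).toLp _), (hmem n).coeFn_toLp] with x h1 h2 h3 h4
    rw [h2, Pi.sub_apply, h3, Pi.smul_apply, h4, h1, smul_eq_mul, div_eq_inv_mul]
  have hc0 : Tendsto (fun n : ℕ => ∫ x, |birkhoffSum T f n x / n - c| ∂μ) atTop (𝓝 0) :=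
    squeeze_zero (fun n => integral_nonneg fun x => abs_nonneg _) hle
      (tendsto_iff_norm_sub_tendsto_zero.1 hlim)
  have hcf : ∫ y, f y ∂μ = c := by
    have h0 : |∫ y, f y ∂μ - c| ≤ 0 := by
      refine ge_of_tendsto hc0 ?_
      filter_upwards [eventually_ge_atTop 1] with n hn
      have hn' : (n : ℝ) ≠ 0 := by positivity
      have hi : Integrable (fun x => birkhoffSum T f n x / n) μ :=
        ((hmem n).integrable (by norm_num)).div_const _
      calc |∫ y, f y ∂μ - c| = |∫ x, (birkhoffSum T f n x / n - c) ∂μ| := by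
            rw [integral_sub hi (integrable_const _), integral_div, integral_birkhoffSum hTm hf hM]
            simp [hn']
        _ ≤ _ := abs_integral_le_integral_abs
    exact sub_eq_zero.1 (abs_nonpos_iff.1 h0)
  rw [hcf]
  exact hc0

/-- The word of length `n` read along the orbit of `x` by the coding map `a`. -/
def itinerary {X ι : Type*} (T : X → X) (a : X → ι) (n : ℕ) (x : X) : Fin n → ι :=
  fun i => a (T^[i] x)

/-- The measure of the cylinder set of a word. -/
noncomputable def wordProb {ι : Type*} (μ : Measure X) (T : X → X) (a : X → ι) (n : ℕ)
    (w : Fin n → ι) : ℝ :=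
  μ.real (itinerary T a n ⁻¹' {w})

/-- The information function of the partition into cylinders of length `n`. -/
noncomputable def wordInfo {ι : Type*} (μ : Measure X) (T : X → X) (a : X → ι) (n : ℕ)
    (x : X) : ℝ :=
  -Real.log (wordProb μ T a n (itinerary T a n x))

/-- The weight of a word under the `k`-step Markov approximation (run backwards in time). -/
noncomputable def markovWeight {ι : Type*} (μ : Measure X) (T : X → X) (a : X → ι) (k : ℕ) :
    (n : ℕ) → (Fin (k + n) → ι) → ℝ
  | 0, w => wordProb μ T a k w
  | n + 1, w =>
    wordProb μ T a (k + 1) (fun i => w (i.castLE (by omega))) /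
      wordProb μ T a k (fun i => w (i.succ.castLE (by omega))) *
      markovWeight μ T a k n (fun i => w i.succ)

theorem exp_neg_wordInfo {ι : Type*} {μ : Measure X} {T : X → X} {a : X → ι} {n : ℕ} {x : X}
    (hx : 0 < wordProb μ T a n (itinerary T a n x)) :
    Real.exp (-wordInfo μ T a n x) = wordProb μ T a n (itinerary T a n x) := by
  rw [wordInfo, neg_neg, Real.exp_log hx]

theorem measurable_itinerary {ι : Type*} [MeasurableSpace ι] {T : X → X} {a : X → ι}
    (hT : Measurable T) (ha : Measurable a) (n : ℕ) : Measurable (itinerary T a n) :=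
  measurable_pi_lambda _ fun i => ha.comp (hT.iterate i)

theorem itinerary_succ {X ι : Type*} (T : X → X) (a : X → ι) (n : ℕ) (x : X) :
    itinerary T a (n + 1) x = Fin.cons (a x) (itinerary T a n (T x)) := by
  ext i
  refine Fin.cases ?_ (fun i => ?_) i <;> simp [itinerary]

theorem wordProb_nonneg {ι : Type*} (μ : Measure X) (T : X → X) (a : X → ι) (n : ℕ)
    (w : Fin n → ι) : 0 ≤ wordProb μ T a n w := measureReal_nonneg

theorem sum_measureReal_preimage_inter {ι : Type*} [Fintype ι] [MeasurableSpace ι]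
    [MeasurableSingletonClass ι]
    {μ : Measure X} [IsFiniteMeasure μ] {a : X → ι}
    (ha : Measurable a) {S : Set X} (hS : MeasurableSet S) :
    ∑ b, μ.real (a ⁻¹' {b} ∩ S) = μ.real S := by
  rw [← measureReal_biUnion_finset]
  · congr 1
    ext x
    simp
  · intro b _ c _ hbc
    refine Disjoint.mono Set.inter_subset_left Set.inter_subset_left ?_
    exact Disjoint.preimage _ (by simpa using hbc)
  · exact fun b _ => (ha (measurableSet_singleton b)).inter hS

theorem sum_wordProb_cons {ι : Type*} [Fintype ι] [MeasurableSpace ι]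
    [MeasurableSingletonClass ι]
    {μ : Measure X} [IsFiniteMeasure μ] {T : X → X} {a : X → ι}
    (hT : MeasurePreserving T μ μ) (ha : Measurable a) (n : ℕ) (w : Fin n → ι) :
    ∑ b, wordProb μ T a (n + 1) (Fin.cons b w) = wordProb μ T a n w := by
  have hm : MeasurableSet (itinerary T a n ⁻¹' {w}) :=
    measurable_itinerary hT.measurable ha n (measurableSet_singleton w)
  have h : ∀ b, itinerary T a (n + 1) ⁻¹' {Fin.cons b w} =
      a ⁻¹' {b} ∩ T ⁻¹' (itinerary T a n ⁻¹' {w}) := by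
    intro b
    ext x
    simp [itinerary_succ, Fin.cons_inj]
  simp only [wordProb, h]
  rw [sum_measureReal_preimage_inter ha (hT.measurable hm), hT.measureReal_preimage
    hm.nullMeasurableSet]

theorem sum_wordProb {ι : Type*} [Fintype ι] [MeasurableSpace ι]
    [MeasurableSingletonClass ι]
    {μ : Measure X} [IsProbabilityMeasure μ] {T : X → X} {a : X → ι}
    (hT : MeasurePreserving T μ μ) (ha : Measurable a) (n : ℕ) :
    ∑ w, wordProb μ T a n w = 1 := by
  simpa [wordProb] using sum_measureReal_preimage_inter (μ := μ)
    (measurable_itinerary hT.measurable ha n) MeasurableSet.univ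

theorem integral_comp_itinerary {ι : Type*} [Fintype ι] [MeasurableSpace ι]
    [MeasurableSingletonClass ι]
    {μ : Measure X} [IsProbabilityMeasure μ] {T : X → X} {a : X → ι}
    (hT : Measurable T) (ha : Measurable a) (n : ℕ) (g : (Fin n → ι) → ℝ) :
    ∫ x, g (itinerary T a n x) ∂μ = ∑ w, wordProb μ T a n w * g w := by
  have hm := measurable_itinerary hT ha n
  have : IsProbabilityMeasure (μ.map (itinerary T a n)) :=
    Measure.isProbabilityMeasure_map hm.aemeasurable
  rw [← integral_map hm.aemeasurable (measurable_of_finite g).aestronglyMeasurable,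
    integral_fintype Integrable.of_finite]
  refine Finset.sum_congr rfl fun w _ => ?_
  rw [map_measureReal_apply hm (measurableSet_singleton w)]
  rfl

theorem ae_wordProb_pos {ι : Type*} [Finite ι] (μ : Measure X) [IsFiniteMeasure μ]
    (T : X → X) (a : X → ι) (n : ℕ) :
    ∀ᵐ x ∂μ, 0 < wordProb μ T a n (itinerary T a n x) := by
  have h : ∀ w : Fin n → ι, ∀ᵐ x ∂μ, itinerary T a n x = w → 0 < wordProb μ T a n w := by
    intro w
    rcases (wordProb_nonneg μ T a n w).eq_or_lt with h0 | h0
    · have h1 : μ (itinerary T a n ⁻¹' {w}) = 0 := (measureReal_eq_zero_iff).1 h0.symm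
      filter_upwards [measure_eq_zero_iff_ae_notMem.1 h1] with x hx hxw
      exact absurd hxw hx
    · exact ae_of_all _ fun x _ => h0
  filter_upwards [ae_all_iff.2 h] with x hx
  exact hx _ rfl

theorem ae_wordProb_orbit_pos {ι : Type*} [Finite ι] {μ : Measure X} [IsFiniteMeasure μ]
    {T : X → X} (hT : MeasurePreserving T μ μ) (a : X → ι) :
    ∀ᵐ x ∂μ, ∀ i n, 0 < wordProb μ T a n (itinerary T a n (T^[i] x)) :=
  ae_all_iff.2 fun i => ae_all_iff.2 fun n =>
    (hT.iterate i).quasiMeasurePreserving.ae (ae_wordProb_pos μ T a n)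

theorem markovWeight_nonneg {ι : Type*} (μ : Measure X) (T : X → X) (a : X → ι) (k n : ℕ)
    (w : Fin (k + n) → ι) : 0 ≤ markovWeight μ T a k n w := by
  induction n with
  | zero => exact wordProb_nonneg ..
  | succ n ih =>
    exact mul_nonneg (div_nonneg (wordProb_nonneg ..) (wordProb_nonneg ..)) (ih _)

theorem sum_markovWeight_le_one {ι : Type*} [Fintype ι] [MeasurableSpace ι]
    [MeasurableSingletonClass ι]
    {μ : Measure X} [IsProbabilityMeasure μ] {T : X → X} {a : X → ι}
    (hT : MeasurePreserving T μ μ) (ha : Measurable a) (k n : ℕ) :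
    ∑ w, markovWeight μ T a k n w ≤ 1 := by
  induction n with
  | zero => exact (sum_wordProb hT ha k).le
  | succ n ih =>
    refine le_trans ?_ ih
    have hcons := (Fin.consEquiv fun _ : Fin (k + n + 1) => ι).sum_comp
      fun w => markovWeight μ T a k (n + 1) w
    refine hcons.symm.trans_le ?_
    rw [Fintype.sum_prod_type_right]
    refine Finset.sum_le_sum fun v _ => ?_
    have h : ∀ b : ι, markovWeight μ T a k (n + 1) (Fin.cons b v : Fin (k + n + 1) → ι) =
        wordProb μ T a (k + 1) (Fin.cons b fun i => v (i.castLE (by omega))) /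
          wordProb μ T a k (fun i => v (i.castLE (by omega))) * markovWeight μ T a k n v := by
      intro b
      rw [markovWeight]
      congr 3
      ext i
      refine Fin.cases ?_ (fun i => ?_) i <;> rfl
    refine (Finset.sum_congr rfl fun b _ => h b).trans_le ?_
    rw [← Finset.sum_mul, ← Finset.sum_div, sum_wordProb_cons hT ha]
    exact mul_le_of_le_one_left (markovWeight_nonneg ..) (div_self_le_one _)

theorem markovWeight_itinerary {ι : Type*} {μ : Measure X} {T : X → X} {a : X → ι} (k n : ℕ)
    {x : X} (hx : ∀ i n, 0 < wordProb μ T a n (itinerary T a n (T^[i] x))) :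
    markovWeight μ T a k n (itinerary T a (k + n) x) =
      Real.exp (-wordInfo μ T a k (T^[n] x) -
        birkhoffSum T (fun y => wordInfo μ T a (k + 1) y - wordInfo μ T a k (T y)) n x) := by
  induction n generalizing x with
  | zero => simpa [markovWeight] using (exp_neg_wordInfo (hx 0 k)).symm
  | succ n ih =>
    have h1 : markovWeight μ T a k (n + 1) (itinerary T a (k + (n + 1)) x) =
        wordProb μ T a (k + 1) (itinerary T a (k + 1) x) /
          wordProb μ T a k (itinerary T a k (T x)) *
          markovWeight μ T a k n (itinerary T a (k + n) (T x)) := rfl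
    rw [h1, ih fun i m => by simpa using hx (i + 1) m, birkhoffSum_succ',
      Function.iterate_succ_apply]
    have h2 : wordProb μ T a (k + 1) (itinerary T a (k + 1) x) =
        Real.exp (-wordInfo μ T a (k + 1) x) :=
      (exp_neg_wordInfo (hx 0 _)).symm
    have h3 : wordProb μ T a k (itinerary T a k (T x)) =
        Real.exp (-wordInfo μ T a k (T x)) :=
      (exp_neg_wordInfo (hx 1 _)).symm
    rw [h2, h3, ← Real.exp_sub, ← Real.exp_add]
    congr 1
    ring

theorem measurable_wordInfo {ι : Type*} [Fintype ι] [MeasurableSpace ι]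
    [MeasurableSingletonClass ι]
    {μ : Measure X} {T : X → X} {a : X → ι}
    (hT : Measurable T) (ha : Measurable a) (n : ℕ) : Measurable (wordInfo μ T a n) :=
  (measurable_of_finite fun w => -Real.log (wordProb μ T a n w)).comp
    (measurable_itinerary hT ha n)

theorem wordInfo_nonneg {ι : Type*} (μ : Measure X) [IsProbabilityMeasure μ] (T : X → X)
    (a : X → ι) (n : ℕ) (x : X) : 0 ≤ wordInfo μ T a n x :=
  neg_nonneg.2 (Real.log_nonpos (wordProb_nonneg ..) measureReal_le_one)

theorem exists_abs_wordInfo_le {ι : Type*} [Finite ι] (μ : Measure X) (T : X → X) (a : X → ι)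
    (n : ℕ) : ∃ M, ∀ x, |wordInfo μ T a n x| ≤ M := by
  obtain ⟨M, hM⟩ := (Set.finite_range fun w => |-Real.log (wordProb μ T a n w)|).bddAbove
  exact ⟨M, fun x => hM ⟨itinerary T a n x, rfl⟩⟩

theorem integral_exp_wordInfo_le_one {ι : Type*} [Fintype ι] [MeasurableSpace ι]
    [MeasurableSingletonClass ι]
    {μ : Measure X} [IsProbabilityMeasure μ] {T : X → X}
    {a : X → ι} (hT : MeasurePreserving T μ μ) (ha : Measurable a) (k n : ℕ) :
    ∫ x, Real.exp (wordInfo μ T a (k + n) x - wordInfo μ T a k (T^[n] x) -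
      birkhoffSum T (fun y => wordInfo μ T a (k + 1) y - wordInfo μ T a k (T y)) n x) ∂μ ≤ 1 := by
  have h : ∀ᵐ x ∂μ, Real.exp (wordInfo μ T a (k + n) x - wordInfo μ T a k (T^[n] x) -
      birkhoffSum T (fun y => wordInfo μ T a (k + 1) y - wordInfo μ T a k (T y)) n x) =
      markovWeight μ T a k n (itinerary T a (k + n) x) /
        wordProb μ T a (k + n) (itinerary T a (k + n) x) := by
    filter_upwards [ae_wordProb_orbit_pos hT a] with x hx
    have h3 : wordProb μ T a (k + n) (itinerary T a (k + n) x) =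
        Real.exp (-wordInfo μ T a (k + n) x) :=
      (exp_neg_wordInfo (hx 0 _)).symm
    rw [markovWeight_itinerary k n hx, h3, ← Real.exp_sub]
    congr 1
    ring
  rw [integral_congr_ae h, integral_comp_itinerary hT.measurable ha (k + n)
    fun w => markovWeight μ T a k n w / wordProb μ T a (k + n) w]
  refine (Finset.sum_le_sum fun w _ => ?_).trans (sum_markovWeight_le_one hT ha k n)
  rw [mul_div_left_comm]
  exact mul_le_of_le_one_right (markovWeight_nonneg ..) (div_self_le_one _)

theorem integral_nonpos_of_integral_exp_le_one {μ : Measure X} [IsProbabilityMeasure μ]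
    {f : X → ℝ} (hf : Integrable f μ) (he : Integrable (fun x => Real.exp (f x)) μ)
    (h : ∫ x, Real.exp (f x) ∂μ ≤ 1) : ∫ x, f x ∂μ ≤ 0 := by
  have h1 : ∫ x, f x ∂μ ≤ ∫ x, (Real.exp (f x) - 1) ∂μ :=
    integral_mono hf (he.sub (integrable_const _)) fun x => by
      linarith [Real.add_one_le_exp (f x)]
  rw [integral_sub he (integrable_const _)] at h1
  simp only [integral_const, probReal_univ, one_smul] at h1
  linarith

theorem integral_abs_le_of_integral_exp_le_one {μ : Measure X} [IsProbabilityMeasure μ]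
    {f : X → ℝ} (hf : Integrable f μ) (he : Integrable (fun x => Real.exp (f x)) μ)
    (h : ∫ x, Real.exp (f x) ∂μ ≤ 1) : ∫ x, |f x| ∂μ ≤ 2 - ∫ x, f x ∂μ := by
  have h1 : ∫ x, |f x| ∂μ ≤ ∫ x, (2 * Real.exp (f x) - f x) ∂μ :=
    integral_mono hf.abs ((he.const_mul 2).sub hf) fun x => by
      rcases abs_cases (f x) with ⟨h0, _⟩ | ⟨h0, _⟩ <;>
        linarith [Real.add_one_le_exp (f x), Real.exp_pos (f x)]
  rw [integral_sub (he.const_mul 2) hf, integral_const_mul] at h1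
  linarith

/-- A nonnegative sequence lying below each of its later secant lines has a linear growth rate,
which is the infimum of its increments. -/
theorem exists_tendsto_div_of_le_add_mul {H : ℕ → ℝ} (h0 : ∀ n, 0 ≤ H n)
    (hH : ∀ k n, H (k + n) ≤ H k + n * (H (k + 1) - H k)) :
    ∃ h : ℝ, Tendsto (fun n : ℕ => H n / n) atTop (𝓝 h) ∧
      (∀ k, h ≤ H (k + 1) - H k) ∧ (∀ n : ℕ, n * h ≤ H n) ∧
      ∀ η > 0, ∃ k, H (k + 1) - H k < h + η := by
  have hd : ∀ k, 0 ≤ H (k + 1) - H k := by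
    intro k
    by_contra! hneg
    obtain ⟨n, hn⟩ := exists_nat_gt (H k / -(H (k + 1) - H k))
    rw [div_lt_iff₀ (by linarith)] at hn
    linarith [hH k n, h0 (k + n)]
  have hbdd : BddBelow (Set.range fun k => H (k + 1) - H k) :=
    ⟨0, Set.forall_mem_range.2 hd⟩
  have hle : ∀ k, (⨅ k, (H (k + 1) - H k)) ≤ H (k + 1) - H k := fun k => ciInf_le hbdd k
  have hex : ∀ η > 0, ∃ k, H (k + 1) - H k < (⨅ k, (H (k + 1) - H k)) + η := fun η hη =>
    exists_lt_of_ciInf_lt (by linarith)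
  generalize (⨅ k, (H (k + 1) - H k)) = h at hle hex
  have hlow : ∀ n : ℕ, n * h ≤ H n := by
    intro n
    induction n with
    | zero => simpa using h0 0
    | succ n ih =>
      push_cast
      linarith [hle n]
  refine ⟨h, ?_, hle, hlow, hex⟩
  rw [Metric.tendsto_atTop]
  intro η hη
  obtain ⟨k, hk⟩ := hex (η / 2) (by linarith)
  obtain ⟨m, hm⟩ := exists_nat_gt (H k / (η / 2))
  refine ⟨max (k + 1) m, fun n hn => ?_⟩
  have hkn : k + 1 ≤ n := le_trans (le_max_left _ _) hn
  have hmn : (m : ℝ) ≤ n := by exact_mod_cast le_trans (le_max_right _ _) hn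
  have hn0 : (0 : ℝ) < n := by
    have : 0 < n := by omega
    exact_mod_cast this
  obtain ⟨j, rfl⟩ := Nat.exists_eq_add_of_le (show k ≤ n by omega)
  rw [div_lt_iff₀ (by linarith)] at hm
  have h1 := hH k j
  have h2 := hlow (k + j)
  have hj : (j : ℝ) ≤ (k + j : ℕ) := by exact_mod_cast Nat.le_add_left j k
  have h3 : (j : ℝ) * (H (k + 1) - H k) ≤ (k + j : ℕ) * (H (k + 1) - H k) :=
    mul_le_mul_of_nonneg_right hj (hd k)
  rw [Real.dist_eq, abs_sub_lt_iff]
  constructor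
  · rw [sub_lt_iff_lt_add, div_lt_iff₀ hn0]
    nlinarith
  · rw [sub_lt_comm, lt_div_iff₀ hn0]
    nlinarith

/-- The Shannon–McMillan theorem: the normalised information functions converge in `L¹`. -/
theorem exists_tendsto_wordInfo_div {ι : Type*} [Fintype ι] [MeasurableSpace ι]
    [MeasurableSingletonClass ι] {μ : Measure X} [IsProbabilityMeasure μ] {T : X → X}
    {a : X → ι} (hT : Ergodic T μ) (ha : Measurable a) :
    ∃ h : ℝ, Tendsto (fun n : ℕ => (∫ x, wordInfo μ T a n x ∂μ) / n) atTop (𝓝 h) ∧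
      Tendsto (fun n : ℕ => ∫ x, |wordInfo μ T a n x / n - h| ∂μ) atTop (𝓝 0) := by
  have hTm := hT.toMeasurePreserving
  set J := wordInfo μ T a
  have hJm : ∀ n, Measurable (J n) := measurable_wordInfo hTm.measurable ha
  choose M hM using exists_abs_wordInfo_le μ T a
  let f : ℕ → X → ℝ := fun k y => J (k + 1) y - J k (T y)
  have hfm : ∀ k, Measurable (f k) := fun k => (hJm _).sub ((hJm _).comp hTm.measurable)
  have hfM : ∀ k x, |f k x| ≤ M (k + 1) + M k := fun k x =>
    (abs_sub _ _).trans (add_le_add (hM _ _) (hM _ _))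
  let L : ℕ → ℕ → X → ℝ := fun k n x => J (k + n) x - J k (T^[n] x) - birkhoffSum T (f k) n x
  have hSm : ∀ k n, Measurable (birkhoffSum T (f k) n) := fun k n =>
    measurable_birkhoffSum hTm.measurable (hfm k) n
  have hLm : ∀ k n, Measurable (L k n) := fun k n =>
    ((hJm _).sub ((hJm _).comp (hTm.iterate n).measurable)).sub (hSm k n)
  have hLM : ∀ k n x, |L k n x| ≤ M (k + n) + M k + n * (M (k + 1) + M k) := fun k n x =>
    (abs_sub _ _).trans (add_le_add ((abs_sub _ _).trans (add_le_add (hM _ _) (hM _ _)))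
      (abs_birkhoffSum_le (hfM k) n x))
  have hJi : ∀ n, Integrable (J n) μ := fun n => integrable_of_abs_le (hJm n) (hM n)
  have hJTi : ∀ k n, Integrable (fun x => J k (T^[n] x)) μ := fun k n =>
    integrable_of_abs_le ((hJm k).comp (hTm.iterate n).measurable) fun x => hM k _
  have hSi : ∀ k n, Integrable (birkhoffSum T (f k) n) μ := fun k n =>
    integrable_of_abs_le (hSm k n) (abs_birkhoffSum_le (hfM k) n)
  have hLi : ∀ k n, Integrable (L k n) μ := fun k n => integrable_of_abs_le (hLm k n) (hLM k n)
  have hei : ∀ k n, Integrable (fun x => Real.exp (L k n x)) μ := fun k n =>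
    integrable_of_abs_le (hLm k n).exp fun x => by
      rw [Real.abs_exp]
      exact Real.exp_le_exp.2 (abs_le.1 (hLM k n x)).2
  have hexp : ∀ k n, ∫ x, Real.exp (L k n x) ∂μ ≤ 1 := integral_exp_wordInfo_le_one hTm ha
  set H : ℕ → ℝ := fun n => ∫ x, J n x ∂μ
  have hJT : ∀ k n, ∫ x, J k (T^[n] x) ∂μ = H k := fun k n =>
    integral_comp_measurePreserving (hTm.iterate n) (hJm k)
  have hf : ∀ k, ∫ x, f k x ∂μ = H (k + 1) - H k := fun k => by
    rw [← hJT k 1]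
    exact integral_sub (hJi _) (hJTi k 1)
  have hL : ∀ k n, ∫ x, L k n x ∂μ = H (k + n) - H k - n * (H (k + 1) - H k) := by
    intro k n
    rw [← hf, ← integral_birkhoffSum hTm (hfm k) (hfM k), ← hJT k n,
      ← integral_sub (hJi _) (hJTi k n)]
    exact integral_sub ((hJi _).sub (hJTi k n)) (hSi k n)
  have hH0 : ∀ n, 0 ≤ H n := fun n => integral_nonneg (wordInfo_nonneg μ T a n)
  obtain ⟨h, hlim, hle, hlow, hex⟩ := exists_tendsto_div_of_le_add_mul hH0 fun k n => by
    have := integral_nonpos_of_integral_exp_le_one (hLi k n) (hei k n) (hexp k n)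
    rw [hL] at this
    linarith
  refine ⟨h, hlim, ?_⟩
  have hh : 0 ≤ h := ge_of_tendsto' hlim fun n => div_nonneg (hH0 n) n.cast_nonneg
  have key : ∀ k n : ℕ, 0 < n → ∫ x, |J (k + n) x / (k + n : ℕ) - h| ∂μ ≤
      (2 + 2 * H k) / n + 2 * (H (k + 1) - H k - h) +
        ∫ x, |birkhoffSum T (f k) n x / n - ∫ y, f k y ∂μ| ∂μ := by
    intro k n hn
    have hn0 : (0 : ℝ) < n := by exact_mod_cast hn
    have hN : (n : ℝ) ≤ (k + n : ℕ) := by exact_mod_cast Nat.le_add_left n k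
    set E := fun x => |birkhoffSum T (f k) n x / n - ∫ y, f k y ∂μ| with hE
    have hEi : Integrable E μ := (((hSi k n).div_const _).sub (integrable_const _)).abs
    have hpt : ∀ x, |J (k + n) x / (k + n : ℕ) - h| ≤
        (|L k n x| + J k (T^[n] x) + (n * (H (k + 1) - H k - h) + k * h)) / (k + n : ℕ) + E x := by
      intro x
      have hN0 : (0 : ℝ) < (k + n : ℕ) := hn0.trans_le hN
      have hE0 : 0 ≤ E x := abs_nonneg _
      have h1 : |birkhoffSum T (f k) n x - n * (H (k + 1) - H k)| = n * E x := by
        rw [hE, hf, ← abs_of_pos hn0, ← abs_mul, abs_of_pos hn0]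
        congr 1
        field_simp
      have h2 : n * E x ≤ (k + n : ℕ) * E x := mul_le_mul_of_nonneg_right hN hE0
      have h3 : J (k + n) x = L k n x + J k (T^[n] x) + birkhoffSum T (f k) n x := by
        simp only [L]
        ring
      have h4 : 0 ≤ J k (T^[n] x) := wordInfo_nonneg μ T a k _
      have h5 : 0 ≤ n * (H (k + 1) - H k - h) :=
        mul_nonneg hn0.le (sub_nonneg.2 (hle k))
      have h6 : 0 ≤ k * h := mul_nonneg k.cast_nonneg hh
      have h7 : |J (k + n) x - (k + n : ℕ) * h| ≤
          |L k n x| + J k (T^[n] x) + (n * (H (k + 1) - H k - h) + k * h) +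
            (k + n : ℕ) * E x := by
        have h8 := h1.le.trans h2
        rw [abs_le] at h8 ⊢
        have h9 := neg_abs_le (L k n x)
        have h10 := le_abs_self (L k n x)
        have h11 : ((k + n : ℕ) : ℝ) * h = k * h + n * h := by
          push_cast
          ring
        rw [h3, h11]
        constructor <;> linarith
      have h8 : J (k + n) x / (k + n : ℕ) - h = (J (k + n) x - (k + n : ℕ) * h) / (k + n : ℕ) := by
        field_simp
      rw [h8, abs_div, abs_of_pos hN0, div_le_iff₀ hN0, add_mul, div_mul_cancel₀ _ hN0.ne']
      linarith
    have hint : ∫ x, |J (k + n) x / (k + n : ℕ) - h| ∂μ ≤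
        (∫ x, |L k n x| ∂μ + H k + (n * (H (k + 1) - H k - h) + k * h)) / (k + n : ℕ) +
          ∫ x, E x ∂μ := by
      have hi1 : Integrable (fun x => |L k n x| + J k (T^[n] x)) μ :=
        (hLi k n).abs.add (hJTi k n)
      have hi2 : Integrable (fun x => |L k n x| + J k (T^[n] x) +
          (n * (H (k + 1) - H k - h) + k * h)) μ := hi1.add (integrable_const _)
      refine (integral_mono (((hJi _).div_const _).sub (integrable_const _)).abs
        ((hi2.div_const _).add hEi) hpt).trans_eq ?_
      rw [integral_add' (hi2.div_const _) hEi, integral_div, integral_add hi1 (integrable_const _),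
        integral_add (hLi k n).abs (hJTi k n), hJT]
      simp
    refine hint.trans ?_
    gcongr
    have hLabs := integral_abs_le_of_integral_exp_le_one (hLi k n) (hei k n) (hexp k n)
    rw [hL] at hLabs
    have h1 := hlow (k + n)
    have h2 : 0 ≤ H (k + 1) - H k - h := sub_nonneg.2 (hle k)
    have h3 : 0 ≤ 2 + 2 * H k := by linarith [hH0 k]
    have hN0 : (0 : ℝ) < (k + n : ℕ) := hn0.trans_le hN
    have h4 : (2 + 2 * H k) / (k + n : ℕ) ≤ (2 + 2 * H k) / n :=
      div_le_div_of_nonneg_left h3 hn0 hN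
    refine le_trans ?_ (add_le_add_left h4 _)
    rw [div_le_iff₀ hN0, add_mul, div_mul_cancel₀ _ hN0.ne']
    have h5 := mul_le_mul_of_nonneg_left hN h2
    push_cast at *
    nlinarith
  rw [Metric.tendsto_atTop]
  intro η hη
  obtain ⟨k, hk⟩ := hex (η / 4) (by linarith)
  have hlim2 : Tendsto (fun n : ℕ => (2 + 2 * H k) / n + 2 * (H (k + 1) - H k - h) +
      ∫ x, |birkhoffSum T (f k) n x / n - ∫ y, f k y ∂μ| ∂μ) atTop
      (𝓝 (0 + 2 * (H (k + 1) - H k - h) + 0)) :=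
    ((tendsto_const_div_atTop_nhds_zero_nat _).add tendsto_const_nhds).add
      (hT.tendsto_integral_abs_birkhoffSum_div (hfm k) (hfM k))
  have hev := (hlim2.eventually_lt_const (show _ < η by linarith)).and (eventually_gt_atTop 0)
  obtain ⟨n₀, hn₀⟩ := eventually_atTop.1 hev
  refine ⟨k + n₀, fun N hN => ?_⟩
  obtain ⟨n, rfl⟩ := Nat.exists_eq_add_of_le (show k ≤ N by omega)
  obtain ⟨h1, h2⟩ := hn₀ n (by omega)
  rw [Real.dist_eq, sub_zero, abs_of_nonneg (integral_nonneg fun x => abs_nonneg _)]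
  exact (key k n h2).trans_lt h1

theorem IsMPartition.exists_coding {α : Finset (Set X)} (hα : IsMPartition α) :
    ∃ (m : ℕ) (a : X → Fin m), Measurable a ∧
      α = Finset.univ.image fun b => a ⁻¹' {b} := by
  obtain ⟨⟨hmeas, hcov⟩, hdisj⟩ := hα
  have hex : ∀ x, ∃ A : α, x ∈ (A : Set X) := fun x => by
    obtain ⟨A, hA, hx⟩ := Set.mem_sUnion.1 (hcov.symm ▸ Set.mem_univ x)
    exact ⟨⟨A, hA⟩, hx⟩
  choose c hc using hex
  have hpre : ∀ A : α, (fun x => α.equivFin (c x)) ⁻¹' {α.equivFin A} = A := by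
    intro A
    ext x
    simp only [Set.mem_preimage, Set.mem_singleton_iff, EmbeddingLike.apply_eq_iff_eq]
    refine ⟨fun h => h ▸ hc x, fun h => ?_⟩
    by_contra hne
    exact (hdisj _ (c x).2 _ A.2 fun h' => hne (Subtype.ext h')).le_bot ⟨hc x, h⟩
  refine ⟨α.card, fun x => α.equivFin (c x), ?_, ?_⟩
  · refine measurable_to_countable' fun b => ?_
    obtain ⟨A, rfl⟩ := α.equivFin.surjective b
    rw [hpre]
    exact hmeas _ A.2
  · ext A
    simp only [Finset.mem_image, Finset.mem_univ, true_and]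
    constructor
    · exact fun hA => ⟨α.equivFin ⟨A, hA⟩, hpre ⟨A, hA⟩⟩
    · rintro ⟨b, rfl⟩
      obtain ⟨A, rfl⟩ := α.equivFin.surjective b
      rw [hpre]
      exact A.2

theorem itinerary_succ_snoc {X ι : Type*} (T : X → X) (a : X → ι) (n : ℕ) (x : X) :
    itinerary T a (n + 1) x = Fin.snoc (itinerary T a n x) (a (T^[n] x)) := by
  ext i
  refine Fin.lastCases ?_ (fun i => ?_) i <;> simp [itinerary]

theorem joinN_eq_image_itinerary {X ι : Type*} [MeasurableSpace X] [Fintype ι] (T : X → X)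
    (a : X → ι) (n : ℕ) :
    joinN T (Finset.univ.image fun b => a ⁻¹' {b}) n =
      Finset.univ.image fun w : Fin n → ι => itinerary T a n ⁻¹' {w} := by
  induction n with
  | zero =>
    ext C
    simp only [joinN, Finset.mem_singleton, Finset.mem_image, Finset.mem_univ, true_and]
    have h : ∀ w : Fin 0 → ι, itinerary T a 0 ⁻¹' {w} = Set.univ := fun w =>
      Set.eq_univ_of_forall fun x => Subsingleton.elim _ _
    simp only [h, exists_const, eq_comm]
  | succ n ih =>
    have h : ∀ (w : Fin n → ι) (b : ι), itinerary T a (n + 1) ⁻¹' {Fin.snoc w b} =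
        itinerary T a n ⁻¹' {w} ∩ T^[n] ⁻¹' (a ⁻¹' {b}) := by
      intro w b
      ext x
      simp [itinerary_succ_snoc, Fin.snoc_inj]
    ext C
    simp only [joinN, cJoin, preC, ih, Finset.mem_image, Finset.mem_product, Finset.mem_univ,
      true_and, Prod.exists]
    constructor
    · rintro ⟨_, _, ⟨⟨w, rfl⟩, _, ⟨b, rfl⟩, rfl⟩, rfl⟩
      exact ⟨Fin.snoc w b, h w b⟩
    · rintro ⟨w, rfl⟩
      refine ⟨_, _, ⟨⟨Fin.init w, rfl⟩, _, ⟨w (Fin.last n), rfl⟩, rfl⟩, ?_⟩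
      rw [← h, Fin.snoc_init_self]

theorem entPart_joinN_eq_integral_wordInfo {ι : Type*} [Fintype ι] [MeasurableSpace ι]
    [MeasurableSingletonClass ι] {μ : Measure X} [IsProbabilityMeasure μ] {T : X → X} {a : X → ι}
    (hT : Measurable T) (ha : Measurable a) (n : ℕ) :
    entPart μ (joinN T (Finset.univ.image fun b => a ⁻¹' {b}) n) =
      ∫ x, wordInfo μ T a n x ∂μ := by
  rw [joinN_eq_image_itinerary, entPart, Finset.sum_image_of_disjoint]
  · refine Eq.trans ?_ (integral_comp_itinerary hT ha n
      fun w => -Real.log (wordProb μ T a n w)).symm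
    refine Finset.sum_congr rfl fun w _ => ?_
    rw [Real.negMulLog, neg_mul, mul_neg]
    rfl
  · simp
  · intro v _ w _ hvw
    exact Disjoint.preimage _ (by simpa using hvw)

theorem wordProb_itinerary_le_exp {ι : Type*} {μ : Measure X} {T : X → X} {a : X → ι} {n : ℕ}
    {x : X} {t : ℝ} (h : t ≤ wordInfo μ T a n x) :
    wordProb μ T a n (itinerary T a n x) ≤ Real.exp (-t) := by
  rcases (wordProb_nonneg μ T a n (itinerary T a n x)).eq_or_lt with h0 | h0
  · rw [← h0]
    exact (Real.exp_pos _).le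
  · rw [← exp_neg_wordInfo h0]
    exact Real.exp_le_exp.2 (neg_le_neg h)

theorem covN_spec {μ : Measure X} {V : Finset (Set X)} {ε : ℝ}
    (hV : 1 - ε < (μ (⋃₀ (V : Set (Set X)))).toReal) :
    ∃ W ⊆ V, W.card = covN μ V ε ∧ 1 - ε < (μ (⋃₀ (W : Set (Set X)))).toReal :=
  Nat.sInf_mem (s := {m | ∃ W ⊆ V, W.card = m ∧ 1 - ε < (μ (⋃₀ (W : Set (Set X)))).toReal})
    ⟨V.card, V, subset_rfl, rfl, hV⟩

theorem covN_le_card {μ : Measure X} {V W : Finset (Set X)} {ε : ℝ} (hWV : W ⊆ V)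
    (hW : 1 - ε < (μ (⋃₀ (W : Set (Set X)))).toReal) : covN μ V ε ≤ W.card :=
  Nat.sInf_le ⟨W, hWV, rfl, hW⟩

theorem covN_le_exp {ι : Type*} [Fintype ι] [MeasurableSpace ι]
    [MeasurableSingletonClass ι] {μ : Measure X} [IsProbabilityMeasure μ] {T : X → X} {a : X → ι}
    (hT : MeasurePreserving T μ μ) (ha : Measurable a) {n : ℕ} {t ε : ℝ}
    (hε : μ.real {x | t < wordInfo μ T a n x} < ε) :
    (covN μ (Finset.univ.image fun w : Fin n → ι => itinerary T a n ⁻¹' {w}) ε : ℝ) ≤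
      Real.exp t := by
  set S := Finset.univ.filter fun w : Fin n → ι => Real.exp (-t) ≤ wordProb μ T a n w
  have hcard : (S.card : ℝ) ≤ Real.exp t := by
    have h1 : (S.card : ℝ) * Real.exp (-t) ≤ ∑ w ∈ S, wordProb μ T a n w := by
      rw [← nsmul_eq_mul]
      exact Finset.card_nsmul_le_sum _ _ _ fun w hw => (Finset.mem_filter.1 hw).2
    have h2 : ∑ w ∈ S, wordProb μ T a n w ≤ 1 := by
      rw [← sum_wordProb hT ha n]
      exact Finset.sum_le_sum_of_subset_of_nonneg (Finset.subset_univ _)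
        fun w _ _ => wordProb_nonneg ..
    rw [Real.exp_neg, ← div_eq_mul_inv] at h1
    have h3 := h1.trans h2
    rwa [div_le_one (Real.exp_pos t)] at h3
  refine le_trans ?_ hcard
  have hle : covN μ (Finset.univ.image fun w : Fin n → ι => itinerary T a n ⁻¹' {w}) ε ≤
      (S.image fun w => itinerary T a n ⁻¹' {w}).card := by
    refine covN_le_card (Finset.image_subset_image (Finset.subset_univ _)) ?_
    have hm : MeasurableSet {x | t < wordInfo μ T a n x} :=
      measurableSet_lt measurable_const (measurable_wordInfo hT.measurable ha n)
    have h1 : μ.real {x | t < wordInfo μ T a n x}ᶜ ≤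
        μ.real (⋃₀ ((S.image fun w => itinerary T a n ⁻¹' {w} : Finset (Set X)) :
          Set (Set X))) := by
      refine ENNReal.toReal_mono (measure_ne_top _ _) (measure_mono_ae ?_)
      filter_upwards [ae_wordProb_pos μ T a n] with x hx hxt
      have hxt' : wordInfo μ T a n x ≤ t := not_lt.1 hxt
      refine Set.mem_sUnion.2 ⟨itinerary T a n ⁻¹' {itinerary T a n x}, ?_, rfl⟩
      refine Finset.mem_coe.2 (Finset.mem_image_of_mem _ ?_)
      refine Finset.mem_filter.2 ⟨Finset.mem_univ _, ?_⟩
      rw [← exp_neg_wordInfo hx]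
      exact Real.exp_le_exp.2 (neg_le_neg hxt')
    rw [probReal_compl_eq_one_sub hm] at h1
    exact lt_of_lt_of_le (by linarith) h1
  exact_mod_cast hle.trans Finset.card_image_le

theorem sUnion_image_itinerary {X ι : Type*} [Fintype ι] (T : X → X) (a : X → ι) (n : ℕ) :
    ⋃₀ ((Finset.univ.image fun w : Fin n → ι => itinerary T a n ⁻¹' {w} : Finset (Set X)) :
      Set (Set X)) = Set.univ :=
  Set.eq_univ_of_forall fun x =>
    Set.mem_sUnion.2 ⟨itinerary T a n ⁻¹' {itinerary T a n x}, by simp, rfl⟩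

theorem le_covN_mul_exp {ι : Type*} [Fintype ι] {μ : Measure X} [IsProbabilityMeasure μ]
    {T : X → X} {a : X → ι} {n : ℕ} {t ε : ℝ} (hε : 0 < ε) :
    1 - ε ≤ μ.real {x | wordInfo μ T a n x < t} +
      covN μ (Finset.univ.image fun w : Fin n → ι => itinerary T a n ⁻¹' {w}) ε *
        Real.exp (-t) := by
  obtain ⟨W, hWV, hcard, hW⟩ := covN_spec (μ := μ) (ε := ε)
    (V := Finset.univ.image fun w : Fin n → ι => itinerary T a n ⁻¹' {w})
    (by simpa only [sUnion_image_itinerary, measure_univ, ENNReal.toReal_one] using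
      sub_lt_self 1 hε)
  set B := {x | wordInfo μ T a n x < t}
  have hsub : ⋃₀ (W : Set (Set X)) ⊆ B ∪ ⋃ C ∈ W, (C \ B) := by
    rintro x ⟨C, hC, hx⟩
    by_cases hxB : x ∈ B
    · exact Or.inl hxB
    · exact Or.inr (Set.mem_biUnion (x := C) hC ⟨hx, hxB⟩)
  have hC : ∀ C ∈ W, μ.real (C \ B) ≤ Real.exp (-t) := by
    intro C hC
    obtain ⟨w, -, rfl⟩ := Finset.mem_image.1 (hWV hC)
    rcases (itinerary T a n ⁻¹' {w} \ B).eq_empty_or_nonempty with h0 | ⟨x, hxw, hxB⟩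
    · rw [h0, measureReal_empty]
      exact (Real.exp_pos _).le
    · obtain rfl : itinerary T a n x = w := hxw
      exact (measureReal_mono Set.sdiff_subset).trans
        (wordProb_itinerary_le_exp (not_lt.1 hxB))
  rw [← hcard]
  calc 1 - ε ≤ μ.real (⋃₀ (W : Set (Set X))) := hW.le
    _ ≤ μ.real (B ∪ ⋃ C ∈ W, (C \ B)) := measureReal_mono hsub
    _ ≤ μ.real B + μ.real (⋃ C ∈ W, (C \ B)) := measureReal_union_le _ _
    _ ≤ μ.real B + ∑ C ∈ W, μ.real (C \ B) := by
      gcongr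
      exact measureReal_biUnion_finset_le _ _
    _ ≤ μ.real B + W.card * Real.exp (-t) := by
      gcongr
      rw [← nsmul_eq_mul]
      exact Finset.sum_le_card_nsmul _ _ _ hC

/-- For an ergodic m.t.d.s. `(X, 𝓑, μ, T)`, a finite measurable
partition `α` and `0 < ε < 1`,
`h_μ(α, T) = lim_n (1/n)·log 𝓝(α₀^{n−1}, ε)`. -/
theorem hPart_eq_lim_log_covN {X : Type*} [MeasurableSpace X] [StandardBorelSpace X]
    (μ : Measure X) [IsProbabilityMeasure μ] (T : X ≃ᵐ X)
    (herg : Ergodic ⇑T μ)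
    (α : Finset (Set X)) (hα : IsMPartition α)
    (ε : ℝ) (hε0 : 0 < ε) (hε1 : ε < 1) :
    Tendsto (fun n : ℕ => Real.log (covN μ (joinN ⇑T α n) ε) / n) atTop
      (𝓝 (hPart μ ⇑T α)) := by
  have hTm := herg.toMeasurePreserving
  obtain ⟨m, a, ha, rfl⟩ := hα.exists_coding
  obtain ⟨h, hlim, hconv⟩ := exists_tendsto_wordInfo_div herg ha
  have hpart : hPart μ ⇑T (Finset.univ.image fun b => a ⁻¹' {b}) = h := by
    refine Tendsto.limUnder_eq ?_
    simpa only [entPart_joinN_eq_integral_wordInfo hTm.measurable ha] using hlim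
  rw [hpart]
  simp only [joinN_eq_image_itinerary]
  rw [Metric.tendsto_atTop]
  intro η hη
  set d := (1 - ε) / 2 with hd
  have hd0 : 0 < d := by linarith
  have hlog : Tendsto (fun n : ℕ => Real.log d / n) atTop (𝓝 0) :=
    tendsto_const_div_atTop_nhds_zero_nat _
  have hev := ((hconv.eventually_lt_const (show 0 < η / 2 * min ε d by positivity)).and
    (hlog.eventually_const_lt (show -(η / 2) < 0 by linarith))).and (eventually_gt_atTop 0)
  refine eventually_atTop.1 (hev.mono ?_)
  rintro n ⟨⟨hn1, hn2⟩, hn⟩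
  have hn0 : (0 : ℝ) < n := by exact_mod_cast hn
  obtain ⟨M, hM⟩ := exists_abs_wordInfo_le μ T a n
  have hint : Integrable (fun x => |wordInfo μ T a n x / n - h|) μ :=
    (((integrable_of_abs_le (measurable_wordInfo hTm.measurable ha n) hM).div_const _).sub
      (integrable_const _)).abs
  have hbad : μ.real {x | η / 2 ≤ |wordInfo μ T a n x / n - h|} < min ε d := by
    have := (mul_meas_ge_le_integral_of_nonneg (ae_of_all _ fun x => abs_nonneg _) hint
      (η / 2)).trans_lt hn1
    exact lt_of_mul_lt_mul_left this (by linarith)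
  have hup := covN_le_exp (n := n) (t := n * (h + η / 2)) (ε := ε) hTm ha (by
    refine (measureReal_mono ?_).trans_lt (hbad.trans_le (min_le_left _ _))
    intro x hx
    have hx' : h + η / 2 < wordInfo μ T a n x / n := by
      rw [lt_div_iff₀ hn0, mul_comm]
      exact hx
    exact (show η / 2 ≤ wordInfo μ T a n x / n - h by linarith).trans (le_abs_self _))
  have hlow := le_covN_mul_exp (μ := μ) (T := T) (a := a) (n := n) (t := n * (h - η / 2)) hε0
  have hbad2 : μ.real {x | wordInfo μ T a n x < n * (h - η / 2)} < d := by
    refine (measureReal_mono ?_).trans_lt (hbad.trans_le (min_le_right _ _))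
    intro x hx
    have hx' : wordInfo μ T a n x / n < h - η / 2 := by
      rw [div_lt_iff₀ hn0, mul_comm]
      exact hx
    exact (show η / 2 ≤ -(wordInfo μ T a n x / n - h) by linarith).trans (neg_le_abs _)
  generalize covN μ _ ε = N at hup hlow ⊢
  have hlow' : d * Real.exp (n * (h - η / 2)) < N := by
    have h1 : d < N * Real.exp (-(n * (h - η / 2))) := by linarith
    rwa [Real.exp_neg, ← div_eq_mul_inv, lt_div_iff₀ (Real.exp_pos _)] at h1
  have hN0 : (0 : ℝ) < N := lt_trans (by positivity) hlow'
  have h1 : Real.log N ≤ n * (h + η / 2) := (Real.log_le_iff_le_exp hN0).2 hup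
  have h2 : Real.log d + n * (h - η / 2) < Real.log N := by
    have := Real.log_lt_log (by positivity) hlow'
    rwa [Real.log_mul hd0.ne' (Real.exp_ne_zero _), Real.log_exp] at this
  rw [lt_div_iff₀ hn0] at hn2
  rw [Real.dist_eq, abs_sub_lt_iff]
  constructor
  · rw [sub_lt_iff_lt_add, div_lt_iff₀ hn0]
    nlinarith
  · rw [sub_lt_comm, lt_div_iff₀ hn0]
    nlinarith
end

section
/- Let (X, 𝓑, μ, T) be an ergodic m.t.d.s. and 𝓤 a cover of X. Then for every 0 < ε < 1 the sequence (1/n)·log 𝓝(𝓤_0^{n−1}, ε) converges as n → ∞, and the value of the limit is the same for all ε ∈ (0, 1). -/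
open MeasureTheory Filter Topology
open scoped Classical

variable {X : Type*} [MeasurableSpace X]

/-- `A` is covered by at most `k` elements of the `n`-fold join of `U` along `S`. -/
def CoveredBy (S : X → X) (U : Finset (Set X)) (n : ℕ) (A : Set X) (k : ℝ) : Prop :=
  ∃ W ⊆ joinN S U n, A ⊆ ⋃₀ (W : Set (Set X)) ∧ (W.card : ℝ) ≤ k

section Covering

variable {Y : Type*} {S : Y → Y} {U : Finset (Set Y)}

theorem inter_preimage_mem_joinN {n m : ℕ} {w v : Set Y} (hw : w ∈ joinN S U n)
    (hv : v ∈ joinN S U m) : w ∩ S^[n] ⁻¹' v ∈ joinN S U (n + m) := by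
  induction m generalizing v with
  | zero =>
    simp only [joinN, Finset.mem_singleton] at hv
    subst hv
    simpa using hw
  | succ m ih =>
    simp only [joinN, cJoin, preC, Finset.mem_image, Finset.mem_product, Prod.exists] at hv
    obtain ⟨v', B, ⟨hv', A, hA, rfl⟩, rfl⟩ := hv
    rw [← add_assoc]
    simp only [joinN, cJoin, preC, Finset.mem_image, Finset.mem_product, Prod.exists]
    refine ⟨_, _, ⟨ih hv', A, hA, rfl⟩, ?_⟩
    rw [Set.preimage_inter, Set.inter_assoc, ← Set.preimage_comp, ← Function.iterate_add,
      Nat.add_comm m n]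

theorem card_joinN_le (n : ℕ) : (joinN S U n).card ≤ U.card ^ n := by
  induction n with
  | zero => simp [joinN]
  | succ n ih =>
    rw [joinN, cJoin, pow_succ]
    refine Finset.card_image_le.trans ?_
    rw [Finset.card_product]
    exact Nat.mul_le_mul ih Finset.card_image_le

theorem sUnion_joinN (hU : ⋃₀ (U : Set (Set Y)) = Set.univ) (n : ℕ) :
    ⋃₀ (joinN S U n : Set (Set Y)) = Set.univ := by
  refine Set.eq_univ_of_forall fun x => ?_
  suffices ∃ w ∈ joinN S U n, x ∈ w by simpa using this
  induction n with
  | zero => exact ⟨Set.univ, by simp [joinN], trivial⟩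
  | succ n ih =>
    obtain ⟨w, hw, hxw⟩ := ih
    obtain ⟨A, hA, hxA⟩ := Set.mem_sUnion.1 (hU.ge (Set.mem_univ (S^[n] x)))
    refine ⟨w ∩ S^[n] ⁻¹' A, ?_, hxw, hxA⟩
    simp only [joinN, cJoin, preC, Finset.mem_image, Finset.mem_product, Prod.exists]
    exact ⟨_, _, ⟨hw, A, hA, rfl⟩, rfl⟩

theorem CoveredBy.mono {n : ℕ} {A B : Set Y} {k l : ℝ} (h : CoveredBy S U n A k)
    (hBA : B ⊆ A) (hkl : k ≤ l) : CoveredBy S U n B l := by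
  obtain ⟨W, hW, hA, hk⟩ := h
  exact ⟨W, hW, hBA.trans hA, hk.trans hkl⟩

theorem coveredBy_empty (n : ℕ) : CoveredBy S U n ∅ 0 :=
  ⟨∅, by simp, by simp, by simp⟩

theorem coveredBy_pow (hU : ⋃₀ (U : Set (Set Y)) = Set.univ) (n : ℕ) (A : Set Y) :
    CoveredBy S U n A ((U.card : ℝ) ^ n) :=
  ⟨joinN S U n, subset_rfl, by simp [sUnion_joinN hU], by exact_mod_cast card_joinN_le n⟩

theorem CoveredBy.union {n : ℕ} {A B : Set Y} {k l : ℝ} (hA : CoveredBy S U n A k)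
    (hB : CoveredBy S U n B l) : CoveredBy S U n (A ∪ B) (k + l) := by
  obtain ⟨W, hW, hA, hk⟩ := hA
  obtain ⟨V, hV, hB, hl⟩ := hB
  refine ⟨W ∪ V, Finset.union_subset hW hV, ?_, ?_⟩
  · rw [Finset.coe_union, Set.sUnion_union]
    exact Set.union_subset_union hA hB
  · have : ((W ∪ V).card : ℝ) ≤ W.card + V.card := by exact_mod_cast Finset.card_union_le W V
    linarith

theorem CoveredBy.biUnion {ι : Type*} {n : ℕ} (s : Finset ι) {A : ι → Set Y} {k : ι → ℝ}
    (h : ∀ i ∈ s, CoveredBy S U n (A i) (k i)) :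
    CoveredBy S U n (⋃ i ∈ s, A i) (∑ i ∈ s, k i) := by
  induction s using Finset.induction_on with
  | empty => simpa using coveredBy_empty n
  | insert a s ha ih =>
    rw [Finset.set_biUnion_insert, Finset.sum_insert ha]
    exact (h a (Finset.mem_insert_self a s)).union
      (ih fun i hi => h i (Finset.mem_insert_of_mem hi))

theorem CoveredBy.inter_preimage {n m : ℕ} {A B : Set Y} {k l : ℝ} (hA : CoveredBy S U n A k)
    (hB : CoveredBy S U m B l) : CoveredBy S U (n + m) (A ∩ S^[n] ⁻¹' B) (k * l) := by
  obtain ⟨W, hW, hA, hk⟩ := hA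
  obtain ⟨V, hV, hB, hl⟩ := hB
  refine ⟨(W ×ˢ V).image fun p => p.1 ∩ S^[n] ⁻¹' p.2, ?_, ?_, ?_⟩
  · intro C hC
    obtain ⟨⟨w, v⟩, hp, rfl⟩ := Finset.mem_image.1 hC
    rw [Finset.mem_product] at hp
    exact inter_preimage_mem_joinN (hW hp.1) (hV hp.2)
  · rintro x ⟨hxA, hxB⟩
    obtain ⟨w, hw, hxw⟩ := hA hxA
    obtain ⟨v, hv, hxv⟩ := hB hxB
    exact ⟨_, Finset.mem_coe.2 (Finset.mem_image.2
      ⟨(w, v), Finset.mem_product.2 ⟨hw, hv⟩, rfl⟩), hxw, hxv⟩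
  · have h : (((W ×ˢ V).image fun p => p.1 ∩ S^[n] ⁻¹' p.2).card : ℝ) ≤ W.card * V.card := by
      exact_mod_cast Finset.card_image_le.trans (Finset.card_product W V).le
    exact h.trans (mul_le_mul hk hl (by positivity) ((Nat.cast_nonneg _).trans hk))

/-- The points whose orbit of length `N` leaves `F` at most `b` times. -/
def fewExits (S : Y → Y) (F : Set Y) (N b : ℕ) : Set Y :=
  {x | ((Finset.range N).filter fun i => S^[i] x ∉ F).card ≤ b}

theorem iterate_mem_fewExits {F : Set Y} {N b l : ℕ} (hl : l ≤ N) {x : Y}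
    (hx : x ∈ fewExits S F N b) : S^[l] x ∈ fewExits S F (N - l) b := by
  refine le_trans ?_ (show _ ≤ b from hx)
  refine Finset.card_le_card_of_injOn (fun i => i + l) ?_ fun i _ j _ h => by simpa using h
  intro i hi
  simp only [Finset.coe_filter, Finset.mem_range, Set.mem_ofPred_eq] at hi ⊢
  refine ⟨by omega, ?_⟩
  rw [Function.iterate_add_apply]
  exact hi.2

theorem apply_mem_fewExits {F : Set Y} {N b : ℕ} {x : Y}
    (hx : x ∈ fewExits S F (N + 1) b) (hxF : x ∉ F) :
    ∃ b', b = b' + 1 ∧ S x ∈ fewExits S F N b' := by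
  have h : ((Finset.range N).filter fun i => S^[i] (S x) ∉ F).card + 1 ≤ b := by
    refine le_trans ?_ (show _ ≤ b from hx)
    rw [← Finset.card_image_of_injective _ Nat.succ_injective,
      ← Finset.card_insert_of_notMem (a := 0) (by simp)]
    refine Finset.card_le_card fun i hi => ?_
    simp only [Finset.mem_insert, Finset.mem_image, Finset.mem_filter, Finset.mem_range] at hi ⊢
    rcases hi with rfl | ⟨j, hj, rfl⟩
    · exact ⟨by omega, hxF⟩
    · exact ⟨by omega, by simpa using hj.2⟩
  exact ⟨b - 1, by omega, show _ ≤ b - 1 by omega⟩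

/-- If `F` is a union of sets `B i`, each economically covered by words of length `ℓ i`, then so
is the set of points whose orbits mostly stay in `F`: cut an orbit into blocks greedily. -/
theorem coveredBy_fewExits {ι : Type*} (hU : ⋃₀ (U : Set (Set Y)) = Set.univ)
    (hcard : 1 ≤ U.card) (s : Finset ι) (ℓ : ι → ℕ) (B : ι → Set Y) (c : ι → ℝ) {θ : ℝ}
    (hθ : 0 ≤ θ) {L : ℕ} (hℓ : ∀ i ∈ s, 1 ≤ ℓ i ∧ ℓ i ≤ L)
    (hB : ∀ i ∈ s, CoveredBy S U (ℓ i) (B i) (c i))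
    (hsum : ∑ i ∈ s, c i * Real.exp (-(θ * ℓ i)) ≤ 1 / 2) (N b : ℕ) :
    CoveredBy S U N (fewExits S (⋃ i ∈ s, B i) N b)
      ((U.card : ℝ) ^ (L + 1) * Real.exp (θ * N) * (2 * U.card : ℝ) ^ b) := by
  have hu : (1 : ℝ) ≤ U.card := by exact_mod_cast hcard
  induction N using Nat.strong_induction_on generalizing b with
  | _ N ih =>
  rcases Nat.lt_or_ge L N with hN | hN
  swap
  · refine (coveredBy_pow hU N _).mono subset_rfl ?_
    have h1 : (1 : ℝ) ≤ Real.exp (θ * N) := Real.one_le_exp (by positivity)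
    have h2 : (1 : ℝ) ≤ (2 * U.card : ℝ) ^ b := one_le_pow₀ (by linarith)
    have h3 : (U.card : ℝ) ^ N ≤ (U.card : ℝ) ^ (L + 1) := pow_le_pow_right₀ hu (by omega)
    have h4 : 0 ≤ (U.card : ℝ) ^ (L + 1) := by positivity
    calc (U.card : ℝ) ^ N ≤ (U.card : ℝ) ^ (L + 1) * 1 * 1 := by linarith
      _ ≤ _ := by gcongr
  · obtain ⟨M, rfl⟩ : ∃ M, N = M + 1 := ⟨N - 1, by omega⟩
    set F := ⋃ i ∈ s, B i with hF
    set C := (U.card : ℝ) ^ (L + 1)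
    have hC : 0 ≤ C := by positivity
    have key1 : CoveredBy S U (M + 1)
        (⋃ i ∈ s, B i ∩ S^[ℓ i] ⁻¹' fewExits S F (M + 1 - ℓ i) b)
        (∑ i ∈ s, c i * (C * Real.exp (θ * (M + 1 - ℓ i : ℕ)) * (2 * U.card : ℝ) ^ b)) := by
      refine CoveredBy.biUnion s fun i hi => ?_
      have h1 := hℓ i hi
      have h2 := (hB i hi).inter_preimage (ih (M + 1 - ℓ i) (by omega) b)
      rwa [show ℓ i + (M + 1 - ℓ i) = M + 1 by omega] at h2
    have key2 : CoveredBy S U (M + 1) (fewExits S F (M + 1) b ∩ Fᶜ)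
        (C * Real.exp (θ * (M + 1 : ℕ)) * (2 * U.card : ℝ) ^ b * (1 / 2)) := by
      rcases b with _ | b
      · refine (coveredBy_empty (M + 1)).mono ?_ (by positivity)
        rintro x ⟨hx, hxF⟩
        obtain ⟨b', hb, -⟩ := apply_mem_fewExits hx hxF
        omega
      · have h := (coveredBy_pow hU 1 (Set.univ : Set Y)).inter_preimage (ih M (by omega) b)
        rw [add_comm 1 M] at h
        refine h.mono ?_ ?_
        · rintro x ⟨hx, hxF⟩
          obtain ⟨b', hb, h⟩ := apply_mem_fewExits hx hxF
          obtain rfl : b = b' := by omega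
          exact ⟨trivial, h⟩
        · have : Real.exp (θ * M) ≤ Real.exp (θ * (M + 1 : ℕ)) := by
            gcongr
            omega
          calc (U.card : ℝ) ^ 1 * (C * Real.exp (θ * M) * (2 * U.card : ℝ) ^ b)
              = C * (U.card * (2 * U.card : ℝ) ^ b) * Real.exp (θ * M) := by ring
            _ ≤ C * (U.card * (2 * U.card : ℝ) ^ b) * Real.exp (θ * (M + 1 : ℕ)) := by gcongr
            _ = _ := by ring
    refine (key1.union key2).mono ?_ ?_
    · intro x hx
      by_cases hxF : x ∈ F
      · left
        obtain ⟨i, hi, hxi⟩ := Set.mem_iUnion₂.1 hxF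
        exact Set.mem_iUnion₂.2 ⟨i, hi, hxi, iterate_mem_fewExits (by have := hℓ i hi; omega) hx⟩
      · exact Or.inr ⟨hx, hxF⟩
    · have h : ∑ i ∈ s, c i * (C * Real.exp (θ * (M + 1 - ℓ i : ℕ)) * (2 * U.card : ℝ) ^ b)
          = (C * Real.exp (θ * (M + 1 : ℕ)) * (2 * U.card : ℝ) ^ b) *
            ∑ i ∈ s, c i * Real.exp (-(θ * ℓ i)) := by
        rw [Finset.mul_sum]
        refine Finset.sum_congr rfl fun i hi => ?_
        have h1 := hℓ i hi
        rw [Nat.cast_sub (by omega), mul_sub, sub_eq_add_neg, Real.exp_add]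
        ring
      rw [h]
      have : 0 ≤ C * Real.exp (θ * (M + 1 : ℕ)) * (2 * U.card : ℝ) ^ b := by positivity
      nlinarith

end Covering

section Measure

variable {μ : Measure X} [IsProbabilityMeasure μ] {S : X → X} {U : Finset (Set X)}

/-- Almost every point visits, within a uniformly bounded waiting time `M`, a set `A n` with `n`
arbitrarily large, provided infinitely many of the `A n` have measure bounded below. -/
theorem Ergodic.exists_lt_measureReal_biUnion_preimage (hS : Ergodic S μ) {A : ℕ → Set X}
    (hA : ∀ n, MeasurableSet (A n)) {c : ℝ} (hc : 0 < c) (hfreq : ∃ᶠ n in atTop, c ≤ μ.real (A n))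
    {r : ℝ} (hr : r < 1) :
    ∃ M : ℕ, ∀ n₀ : ℕ, ∃ n₁ : ℕ,
      r < μ.real (⋃ p ∈ Finset.range M ×ˢ Finset.Ico n₀ n₁, S^[p.1] ⁻¹' A p.2) := by
  set E : ℕ → Set X := fun m => ⋃ n ≥ m, A n
  have hEm : ∀ m, MeasurableSet (E m) := fun m =>
    MeasurableSet.iUnion fun n => MeasurableSet.iUnion fun _ => hA n
  have hEanti : Antitone E := fun m m' h =>
    Set.iUnion₂_subset fun n hn => Set.subset_iUnion₂_of_subset n (le_trans h hn) subset_rfl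
  have hEc : c ≤ μ.real (⋂ m, E m) := by
    have h := tendsto_measure_iInter_atTop (μ := μ) (fun m => (hEm m).nullMeasurableSet) hEanti
      ⟨0, measure_ne_top _ _⟩
    refine ge_of_tendsto ((ENNReal.tendsto_toReal (measure_ne_top _ _)).comp h)
      (Eventually.of_forall fun m => ?_)
    obtain ⟨n, hn, hcn⟩ := (frequently_atTop.1 hfreq) m
    exact hcn.trans (measureReal_mono (Set.subset_iUnion₂_of_subset n hn subset_rfl)
      (measure_ne_top _ _))
  have hiter : ∀ j, Measurable S^[j] := fun j => hS.measurable.iterate j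
  set G : Set X := ⋃ j : ℕ, S^[j] ⁻¹' ⋂ m, E m with hG
  have hGm : MeasurableSet G :=
    MeasurableSet.iUnion fun j => hiter j (MeasurableSet.iInter hEm)
  have hG1 : G =ᵐ[μ] Set.univ := by
    refine (hS.ae_empty_or_univ_of_preimage_ae_le hGm.nullMeasurableSet
      (LE.le.eventuallyLE ?_)).resolve_left fun h => ?_
    · intro x hx
      obtain ⟨j, hj⟩ := Set.mem_iUnion.1 hx
      exact Set.mem_iUnion.2 ⟨j + 1, hj⟩
    · have h0 : μ.real (⋂ m, E m) ≤ μ.real G :=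
        measureReal_mono (Set.subset_iUnion_of_subset 0 subset_rfl)
      rw [measureReal_congr h, measureReal_empty] at h0
      linarith
  have hGlim := tendsto_measure_iUnion_accumulate (μ := μ) (f := fun j => S^[j] ⁻¹' ⋂ m, E m)
  rw [← hG, measure_congr hG1, measure_univ] at hGlim
  obtain ⟨M, hM⟩ := (((ENNReal.tendsto_toReal ENNReal.one_ne_top).comp hGlim).eventually
    (lt_mem_nhds (by simpa using hr))).exists
  refine ⟨M + 1, fun n₀ => ?_⟩
  set D : ℕ → Set X := fun n₁ =>
    ⋃ p ∈ Finset.range (M + 1) ×ˢ Finset.Ico n₀ n₁, S^[p.1] ⁻¹' A p.2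
  have hDmono : Monotone D := fun a b hab =>
    Set.biUnion_subset_biUnion_left fun p hp => by
      simp only [SetLike.mem_coe, Finset.mem_product, Finset.mem_range, Finset.mem_Ico] at hp ⊢
      omega
  have hsub : Set.accumulate (fun j => S^[j] ⁻¹' ⋂ m, E m) M ⊆ ⋃ n₁, D n₁ := by
    intro x hx
    obtain ⟨j, hj, hxj⟩ := Set.mem_iUnion₂.1 hx
    obtain ⟨n, hn, hxn⟩ := Set.mem_iUnion₂.1 (Set.mem_iInter.1 hxj n₀)
    refine Set.mem_iUnion.2 ⟨n + 1, Set.mem_iUnion₂.2 ⟨(j, n), ?_, hxn⟩⟩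
    simp only [Finset.mem_product, Finset.mem_range, Finset.mem_Ico]
    omega
  have hlim := (ENNReal.tendsto_toReal (measure_ne_top μ _)).comp
    (tendsto_measure_iUnion_atTop (μ := μ) hDmono)
  exact (hlim.eventually (lt_mem_nhds (lt_of_lt_of_le hM (measureReal_mono hsub)))).exists

theorem measurableSet_fewExits (hS : Measurable S) {F : Set X} (hF : MeasurableSet F)
    (N b : ℕ) : MeasurableSet (fewExits S F N b) := by
  have h : Measurable fun x => ∑ i ∈ Finset.range N, (S^[i] ⁻¹' Fᶜ).indicator (fun _ => 1) x :=
    Finset.measurable_sum _ fun i _ =>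
      measurable_const.indicator (hS.iterate i hF.compl)
  have h' := h (measurableSet_Iic (a := b))
  convert h' using 1
  ext x
  simp [fewExits, Finset.card_filter, Set.indicator_apply]

theorem MeasureTheory.MeasurePreserving.measureReal_compl_fewExits_le
    (hS : MeasurePreserving S μ μ) {F : Set X} (hF : MeasurableSet F) (N b : ℕ) :
    (b + 1) * μ.real (fewExits S F N b)ᶜ ≤ N * μ.real Fᶜ := by
  have hm : ∀ i, MeasurableSet (S^[i] ⁻¹' Fᶜ) := fun i => hS.measurable.iterate i hF.compl
  set g : X → ENNReal := fun x => ∑ i ∈ Finset.range N, (S^[i] ⁻¹' Fᶜ).indicator 1 x with hg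
  have hgm : Measurable g :=
    Finset.measurable_sum _ fun i _ => measurable_one.indicator (hm i)
  have hint : ∫⁻ x, g x ∂μ = N * μ Fᶜ := by
    rw [hg, lintegral_finsetSum _ fun i _ => measurable_one.indicator (hm i)]
    simp_rw [lintegral_indicator_one (hm _),
      (hS.iterate _).measure_preimage hF.compl.nullMeasurableSet]
    simp
  have hsub : (fewExits S F N b)ᶜ ⊆ {x | ((b + 1 : ℕ) : ENNReal) ≤ g x} := by
    intro x hx
    have hgx : g x = (((Finset.range N).filter fun i => S^[i] x ∉ F).card : ℕ) := by
      simp [hg, Finset.card_filter, Set.indicator_apply]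
    have hx' : b < ((Finset.range N).filter fun i => S^[i] x ∉ F).card := not_le.1 hx
    change _ ≤ g x
    rw [hgx]
    exact_mod_cast hx'
  have h := (mul_le_mul_right (measure_mono hsub) _).trans
    (mul_meas_ge_le_lintegral (μ := μ) hgm ((b + 1 : ℕ) : ENNReal))
  rw [hint] at h
  have h' := ENNReal.toReal_mono (ENNReal.mul_ne_top (by simp) (measure_ne_top _ _)) h
  rw [ENNReal.toReal_mul, ENNReal.toReal_mul, ENNReal.toReal_natCast, ENNReal.toReal_natCast] at h'
  exact_mod_cast h'

theorem covN_le_of_coveredBy {n : ℕ} {A : Set X} {k ε : ℝ} (h : CoveredBy S U n A k)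
    (hA : 1 - ε < μ.real A) : (covN μ (joinN S U n) ε : ℝ) ≤ k := by
  obtain ⟨W, hW, hAW, hk⟩ := h
  refine le_trans ?_ hk
  have h : covN μ (joinN S U n) ε ≤ W.card :=
    Nat.sInf_le ⟨W, hW, rfl, hA.trans_le (measureReal_mono hAW)⟩
  exact_mod_cast h

theorem exists_card_eq_covN (hU : ⋃₀ (U : Set (Set X)) = Set.univ) {ε : ℝ} (hε : 0 < ε) (n : ℕ) :
    ∃ W ⊆ joinN S U n, W.card = covN μ (joinN S U n) ε ∧
      1 - ε < μ.real (⋃₀ (W : Set (Set X))) :=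
  Nat.sInf_mem (s := {m | ∃ W ⊆ joinN S U n, W.card = m ∧
      1 - ε < (μ (⋃₀ (W : Set (Set X)))).toReal})
    ⟨_, joinN S U n, subset_rfl, rfl, by simp [sUnion_joinN hU, hε]⟩

theorem measurableSet_of_mem_joinN (hS : Measurable S) (hU : ∀ A ∈ U, MeasurableSet A) {n : ℕ}
    {w : Set X} (hw : w ∈ joinN S U n) : MeasurableSet w := by
  induction n generalizing w with
  | zero =>
    simp only [joinN, Finset.mem_singleton] at hw
    exact hw ▸ MeasurableSet.univ
  | succ n ih =>
    simp only [joinN, cJoin, preC, Finset.mem_image, Finset.mem_product, Prod.exists] at hw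
    obtain ⟨v, B, ⟨hv, A, hA, rfl⟩, rfl⟩ := hw
    exact (ih hv).inter (hS.iterate n (hU A hA))

theorem sum_mul_exp_le {M n₀ n₁ : ℕ} {u a θ : ℝ} (hu : 1 ≤ u) (hθ : 0 ≤ θ) (haθ : a < θ) :
    ∑ p ∈ Finset.range M ×ˢ Finset.Ico n₀ n₁,
        u ^ p.1 * Real.exp (a * p.2) * Real.exp (-(θ * (p.1 + p.2 : ℕ))) ≤
      M * u ^ M * (Real.exp (-(θ - a)) ^ n₀ / (1 - Real.exp (-(θ - a)))) := by
  have hr : Real.exp (-(θ - a)) < 1 := Real.exp_lt_one_iff.2 (by linarith)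
  calc _ ≤ ∑ p ∈ Finset.range M ×ˢ Finset.Ico n₀ n₁, u ^ M * Real.exp (-(θ - a)) ^ p.2 := by
        refine Finset.sum_le_sum fun p hp => ?_
        have hp1 : p.1 ≤ M := by
          have := Finset.mem_range.1 (Finset.mem_product.1 hp).1
          omega
        rw [mul_assoc, ← Real.exp_add, ← Real.exp_nat_mul]
        have : 0 ≤ θ * p.1 := by positivity
        gcongr
        · push_cast
          linarith
    _ = M * u ^ M * ∑ n ∈ Finset.Ico n₀ n₁, Real.exp (-(θ - a)) ^ n := by
        rw [Finset.sum_product]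
        simp [← Finset.mul_sum, mul_assoc]
    _ ≤ _ := by
        gcongr
        exact geom_sum_Ico_le_of_lt_one (Real.exp_pos _).le hr

/-- For an ergodic map the upper growth rate of `covN` at any level in `(0, 1)` is at most
the lower growth rate at any other level. -/
theorem Ergodic.eventually_log_covN_lt (hS : Ergodic S μ) (hU : IsMCover U) {ε ε' a δ : ℝ}
    (hε : 0 < ε) (hε1 : ε < 1) (hε' : 0 < ε') (hδ : 0 < δ)
    (hfreq : ∃ᶠ n : ℕ in atTop, Real.log (covN μ (joinN S U n) ε) / n < a) :
    ∀ᶠ n : ℕ in atTop, Real.log (covN μ (joinN S U n) ε') / n < a + δ := by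
  obtain ⟨hUm, hUc⟩ := hU
  have hUcard : 1 ≤ U.card := by
    rw [Nat.one_le_iff_ne_zero, Finset.card_ne_zero, Finset.nonempty_iff_ne_empty]
    rintro rfl
    have h := measure_univ (μ := μ)
    simp [← hUc] at h
  have hu : (1 : ℝ) ≤ U.card := by exact_mod_cast hUcard
  have ha : 0 < a := by
    obtain ⟨n, hn⟩ := hfreq.exists
    exact lt_of_le_of_lt (div_nonneg (Real.log_natCast_nonneg _) n.cast_nonneg) hn
  choose W hWsub hWcard hWμ using fun n => exists_card_eq_covN (S := S) (μ := μ) hUc hε n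
  set P : ℕ → Prop := fun n => 1 ≤ n ∧ Real.log (covN μ (joinN S U n) ε) / n < a
  set A : ℕ → Set X := fun n => if P n then ⋃₀ (W n : Set (Set X)) else ∅ with hA
  have hAm : ∀ n, MeasurableSet (A n) := by
    intro n
    simp only [hA]
    split_ifs
    · exact Set.Finite.measurableSet_sUnion (W n).finite_toSet fun w hw =>
        measurableSet_of_mem_joinN hS.measurable hUm (hWsub n hw)
    · exact MeasurableSet.empty
  have hAcov : ∀ n, CoveredBy S U n (A n) (Real.exp (a * n)) := by
    intro n
    simp only [hA]
    split_ifs with hn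
    · refine ⟨W n, hWsub n, subset_rfl, ?_⟩
      rw [hWcard]
      have hn0 : (0 : ℝ) < n := by exact_mod_cast hn.1
      exact (Real.le_exp_log _).trans (Real.exp_le_exp.2 ((div_lt_iff₀ hn0).1 hn.2).le)
    · exact (coveredBy_empty n).mono subset_rfl (Real.exp_pos _).le
  have hAfreq : ∃ᶠ n in atTop, 1 - ε ≤ μ.real (A n) := by
    refine (hfreq.and_eventually (eventually_ge_atTop 1)).mono fun n hn => ?_
    have : P n := ⟨hn.2, hn.1⟩
    simp only [hA, if_pos this]
    exact (hWμ n).le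
  set K : ℝ := 2 * U.card with hK
  have hlogK : 0 < Real.log K := Real.log_pos (by linarith)
  set γ : ℝ := δ / 3 / Real.log K with hγ
  have hγ0 : 0 < γ := by positivity
  set θ : ℝ := a + δ / 3 with hθ
  have hθ0 : 0 ≤ θ := by positivity
  obtain ⟨M, hM⟩ := hS.exists_lt_measureReal_biUnion_preimage hAm (sub_pos.2 hε1) hAfreq
    (r := 1 - γ * ε') (by nlinarith [mul_pos hγ0 hε'])
  have hr : Real.exp (-(θ - a)) < 1 := Real.exp_lt_one_iff.2 (by linarith)
  obtain ⟨n₀, hn₀, hn₀'⟩ : ∃ n₀ : ℕ, M * (U.card : ℝ) ^ M *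
      (Real.exp (-(θ - a)) ^ n₀ / (1 - Real.exp (-(θ - a)))) < 1 / 2 ∧ 1 ≤ n₀ := by
    have h := ((tendsto_pow_atTop_nhds_zero_of_lt_one (Real.exp_pos _).le hr).div_const
      (1 - Real.exp (-(θ - a)))).const_mul (M * (U.card : ℝ) ^ M)
    rw [zero_div, mul_zero] at h
    exact ((h.eventually (gt_mem_nhds one_half_pos)).and (eventually_ge_atTop 1)).exists
  obtain ⟨n₁, hn₁⟩ := hM n₀
  set s := Finset.range M ×ˢ Finset.Ico n₀ n₁ with hs
  set F := ⋃ p ∈ s, S^[p.1] ⁻¹' A p.2 with hF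
  have hFm : MeasurableSet F := Finset.measurableSet_biUnion s fun p _ =>
    hS.measurable.iterate p.1 (hAm p.2)
  have hcov := coveredBy_fewExits hUc hUcard s (fun p => p.1 + p.2)
    (fun p => S^[p.1] ⁻¹' A p.2) (fun p => (U.card : ℝ) ^ p.1 * Real.exp (a * p.2)) hθ0
    (L := M + n₁)
    (fun p hp => by
      simp only [hs, Finset.mem_product, Finset.mem_range, Finset.mem_Ico] at hp
      omega)
    (fun p _ => by
      simpa using (coveredBy_pow hUc p.1 (Set.univ : Set X)).inter_preimage (hAcov p.2))
    ((sum_mul_exp_le hu hθ0 (by linarith)).trans hn₀.le)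
  rw [← hF] at hcov
  set C : ℝ := (U.card : ℝ) ^ (M + n₁ + 1)
  have hC0 : 0 < C := by positivity
  have hsmall : ∀ᶠ N : ℕ in atTop, Real.log C / N < δ / 3 :=
    (tendsto_const_div_atTop_nhds_zero_nat _).eventually (gt_mem_nhds (by positivity))
  filter_upwards [hsmall, eventually_ge_atTop 1] with N hN hN1
  have hN0 : (0 : ℝ) < N := by exact_mod_cast hN1
  set b := ⌊γ * N⌋₊
  have hb1 : γ * N < b + 1 := Nat.lt_floor_add_one _
  have hb2 : (b : ℝ) ≤ γ * N := Nat.floor_le (by positivity)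
  have hmeas : 1 - ε' < μ.real (fewExits S F N b) := by
    have h := hS.toMeasurePreserving.measureReal_compl_fewExits_le hFm N b
    rw [measureReal_compl hFm, measureReal_compl (measurableSet_fewExits hS.measurable hFm N b),
      probReal_univ] at h
    by_contra! hcon
    have h1 : γ * N * ε' ≤ (b + 1) * (1 - μ.real (fewExits S F N b)) :=
      mul_le_mul hb1.le (by linarith) hε'.le (by positivity)
    nlinarith
  have hle := covN_le_of_coveredBy (hcov N b) hmeas
  rw [div_lt_iff₀ hN0]
  have hlog : Real.log (covN μ (joinN S U N) ε') ≤
      Real.log (C * Real.exp (θ * N) * K ^ b) := by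
    rcases Nat.eq_zero_or_pos (covN μ (joinN S U N) ε') with h0 | h0
    · have h1 : 1 ≤ C := one_le_pow₀ hu
      have h2 : 1 ≤ Real.exp (θ * N) := Real.one_le_exp (by positivity)
      have h3 : 1 ≤ K ^ b := one_le_pow₀ (by linarith)
      rw [h0, Nat.cast_zero, Real.log_zero]
      exact Real.log_nonneg (one_le_mul_of_one_le_of_one_le
        (one_le_mul_of_one_le_of_one_le h1 h2) h3)
    · exact Real.log_le_log (by exact_mod_cast h0) hle
  rw [Real.log_mul (by positivity) (by positivity), Real.log_mul (by positivity) (by positivity),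
    Real.log_exp, Real.log_pow K b] at hlog
  have h4 : b * Real.log K ≤ δ / 3 * N := by
    calc b * Real.log K ≤ γ * N * Real.log K := by gcongr
      _ = δ / 3 * N := by rw [hγ]; field_simp
  rw [div_lt_iff₀ hN0] at hN
  nlinarith

end Measure

/-- For an ergodic m.t.d.s. `(X, 𝓑, μ, T)` and a cover `𝓤`, for every
`0 < ε < 1` the sequence `(1/n)·log 𝓝(𝓤₀^{n−1}, ε)` converges, with limit
independent of `ε`. -/
theorem lim_log_covN_exists_indep {X : Type*} [MeasurableSpace X] [StandardBorelSpace X]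
    (μ : Measure X) [IsProbabilityMeasure μ] (T : X ≃ᵐ X)
    (herg : Ergodic ⇑T μ)
    (U : Finset (Set X)) (hU : IsMCover U) :
    ∃ h : ℝ, ∀ ε : ℝ, 0 < ε → ε < 1 →
      Tendsto (fun n : ℕ => Real.log (covN μ (joinN ⇑T U n) ε) / n) atTop (𝓝 h) := by
  set u : ℝ → ℕ → ℝ := fun ε n => Real.log (covN μ (joinN ⇑T U n) ε) / n
  have hu0 : ∀ ε n, 0 ≤ u ε n := fun ε n =>
    div_nonneg (Real.log_natCast_nonneg _) n.cast_nonneg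
  have key : ∀ {ε ε' a δ : ℝ}, 0 < ε → ε < 1 → 0 < ε' → 0 < δ →
      (∃ᶠ n in atTop, u ε n < a) → ∀ᶠ n in atTop, u ε' n < a + δ :=
    fun h1 h2 h3 h4 h5 => herg.eventually_log_covN_lt hU h1 h2 h3 h4 h5
  set s : Set ℝ := {a | ∃ᶠ n in atTop, u (1 / 2) n < a}
  have hbdd : BddBelow s := ⟨0, fun a ha => by
    obtain ⟨n, hn⟩ := Frequently.exists ha
    exact (hu0 _ n).trans hn.le⟩
  have hne : s.Nonempty := by
    refine ⟨Real.log U.card + 1, Eventually.frequently ?_⟩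
    filter_upwards [eventually_ge_atTop 1] with n hn
    have hn0 : (0 : ℝ) < n := by exact_mod_cast hn
    have hle := covN_le_of_coveredBy (μ := μ) (ε := 1 / 2)
      (coveredBy_pow (S := ⇑T) hU.2 n Set.univ) (by rw [probReal_univ]; norm_num)
    have hlog : Real.log (covN μ (joinN ⇑T U n) (1 / 2)) ≤ n * Real.log U.card := by
      rcases Nat.eq_zero_or_pos (covN μ (joinN ⇑T U n) (1 / 2)) with h0 | h0
      · rw [h0, Nat.cast_zero, Real.log_zero]
        exact mul_nonneg hn0.le (Real.log_natCast_nonneg _)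
      · rw [← Real.log_pow]
        exact Real.log_le_log (by exact_mod_cast h0) hle
    rw [div_lt_iff₀ hn0]
    nlinarith
  refine ⟨sInf s, fun ε hε hε1 => tendsto_order.2 ⟨fun a ha => ?_, fun a ha => ?_⟩⟩
  · by_contra hcon
    have hfreq : ∃ᶠ n in atTop, u ε n < a + (sInf s - a) / 3 := by
      refine (not_eventually.1 hcon).mono fun n hn => ?_
      have : u ε n ≤ a := not_lt.1 hn
      linarith
    have h := (key hε hε1 one_half_pos (δ := (sInf s - a) / 3) (by linarith) hfreq).frequently
    have := csInf_le hbdd (show _ ∈ s from h)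
    linarith
  · obtain ⟨b, hb, hba⟩ := exists_lt_of_csInf_lt hne ha
    have h := key one_half_pos one_half_lt_one hε (sub_pos.2 hba) hb
    simpa using h
end

section
/- For every l ≥ 1 there exists a positive function φ = φ(N₁,…,N_l, η₁,…,η_l, ε), defined for N₁ < N₂ < … < N_l in ℕ and η_i, ε > 0, such that limsup_{ε→0} limsup_{N₁→∞} limsup_{η₁→0} ⋯ limsup_{N_l→∞} limsup_{η_l→0} φ = 0, and such that for every K ∈ ℕ and all 0 < λ_j < 1 (j = 1,…,l): if {I_i^j}_{i∈A_j}, j = 1,…,l, are separated collections of subintervals of [1, K] satisfying (a) |I_i^j| = N_j for all i ∈ A_j; (b) each {I_i^j}_{i∈A_j} is a (λ_j, ε)-separated cover of [1, K]; and (c) for every 1 ≤ j < r ≤ l, the number of subintervals J of [1, K] of length N_r that are NOT (λ_j, ε)-separately covered by the collection {I_i^j : I_i^j ⊆ J} is less than η_r·K; then there exist subsets Ã_j ⊆ A_j (j = 1,…,l) such that the combined collection {I_i^j : i ∈ Ã_j, 1 ≤ j ≤ l} is separated and is a (1 − ν₁(λ⃗), φ(N₁,…,N_l, η₁,…,η_l,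 ε))-separated cover of [1, K]. -/
open Filter Topology
open scoped Classical

/-- The interval of naturals encoded by a pair `p = (a, N)` (left endpoint `a`,
length `N`): the interval `[a, a + N − 1]`. -/
def ivl (p : ℕ × ℕ) : Finset ℕ := Finset.Icc p.1 (p.1 + p.2 - 1)

/-- Two (encoded) intervals are separated: there is a natural number strictly
between them. -/
def SepPair (p q : ℕ × ℕ) : Prop := p.1 + p.2 < q.1 ∨ q.1 + q.2 < p.1

/-- A collection of (encoded) intervals is separated if any two distinct members
are separated. -/
def SepColl (C : Finset (ℕ × ℕ)) : Prop :=
  ∀ p ∈ C, ∀ q ∈ C, p ≠ q → SepPair p q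

/-- `C` is a `(lam, eps)`-separated cover of the interval `[a, b]`: it is a
separated collection of subintervals of `[a, b]` with
`| |⋃ C| / |[a,b]| − lam | < eps`. -/
def SepCovOn (C : Finset (ℕ × ℕ)) (a b : ℕ) (lam eps : ℝ) : Prop :=
  SepColl C ∧ (∀ p ∈ C, a ≤ p.1 ∧ p.1 + p.2 - 1 ≤ b) ∧
    |((C.biUnion ivl).card : ℝ) / ((b - a + 1 : ℕ) : ℝ) - lam| < eps

/-- The alternating quantifier chain expressing the iterated limsup condition
`limsup_{N_{j}→∞} limsup_{η_{j}→0} ⋯ limsup_{N_l→∞} limsup_{η_l→0} ψ(N, η) < c`,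
consuming the indices in the given list one at a time (first a threshold for
`N_j`, then a bound for `η_j`, and so on). -/
def LimsupChain {l : ℕ} (ψ : (Fin l → ℕ) → (Fin l → ℝ) → ℝ) (c : ℝ) :
    List (Fin l) → (Fin l → ℕ) → (Fin l → ℝ) → Prop
  | [], N, η => ψ N η < c
  | j :: rest, N, η => ∃ M : ℕ, ∀ n : ℕ, M ≤ n → ∃ e : ℝ, 0 < e ∧ ∀ h : ℝ,
      0 < h → h < e →
        LimsupChain ψ c rest (Function.update N j n) (Function.update η j h)

theorem card_ivl {p : ℕ × ℕ} (hp : 1 ≤ p.2) : (ivl p).card = p.2 := by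
  simp only [ivl, Nat.card_Icc]
  omega

theorem SepPair.symm {p q : ℕ × ℕ} (h : SepPair p q) : SepPair q p := Or.symm h

theorem not_sepPair_self (p : ℕ × ℕ) : ¬ SepPair p p := by
  simp only [SepPair]
  omega

theorem SepPair.disjoint_ivl {p q : ℕ × ℕ} (h : SepPair p q) : Disjoint (ivl p) (ivl q) := by
  rw [Finset.disjoint_left]
  intro x hx hy
  simp only [ivl, Finset.mem_Icc] at hx hy
  rcases h with h | h <;> omega

theorem SepColl.mono {C C' : Finset (ℕ × ℕ)} (h : SepColl C) (hC : C' ⊆ C) : SepColl C' :=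
  fun p hp q hq hpq => h p (hC hp) q (hC hq) hpq

theorem SepColl.union {C C' : Finset (ℕ × ℕ)} (h : SepColl C) (h' : SepColl C')
    (hC : ∀ p ∈ C, ∀ q ∈ C', SepPair p q) : SepColl (C ∪ C') := by
  intro p hp q hq hpq
  rcases Finset.mem_union.1 hp with hp | hp <;> rcases Finset.mem_union.1 hq with hq | hq
  · exact h p hp q hq hpq
  · exact hC p hp q hq
  · exact (hC q hq p hp).symm
  · exact h' p hp q hq hpq

theorem SepColl.card_biUnion_ivl {C : Finset (ℕ × ℕ)} (h : SepColl C)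
    (hC : ∀ p ∈ C, 1 ≤ p.2) : (C.biUnion ivl).card = ∑ p ∈ C, p.2 := by
  rw [Finset.card_biUnion fun p hp q hq hpq => (h p hp q hq hpq).disjoint_ivl]
  exact Finset.sum_congr rfl fun p hp => card_ivl (hC p hp)

theorem SepColl.sum_length_le {C : Finset (ℕ × ℕ)} {a b : ℕ} (h : SepColl C)
    (hC : ∀ p ∈ C, 1 ≤ p.2) (hab : ∀ p ∈ C, a ≤ p.1 ∧ p.1 + p.2 - 1 ≤ b) :
    ∑ p ∈ C, p.2 ≤ b + 1 - a := by
  rw [← h.card_biUnion_ivl hC, ← Nat.card_Icc]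
  refine Finset.card_le_card (Finset.biUnion_subset.2 fun p hp => ?_)
  exact Finset.Icc_subset_Icc (hab p hp).1 (hab p hp).2

/-- The intervals of length `n` with left endpoints in `A`. -/
def ivls (A : Finset ℕ) (n : ℕ) : Finset (ℕ × ℕ) := A.image fun a => (a, n)

theorem mem_ivls {A : Finset ℕ} {n : ℕ} {p : ℕ × ℕ} : p ∈ ivls A n ↔ p.1 ∈ A ∧ p.2 = n := by
  obtain ⟨a, m⟩ := p
  simp only [ivls, Finset.mem_image, Prod.mk.injEq]
  constructor
  · rintro ⟨b, hb, rfl, rfl⟩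
    exact ⟨hb, rfl⟩
  · rintro ⟨h, rfl⟩
    exact ⟨a, h, rfl, rfl⟩

theorem ivls_mono {A B : Finset ℕ} (h : A ⊆ B) (n : ℕ) : ivls A n ⊆ ivls B n :=
  Finset.image_subset_image h

theorem sum_ivls {M : Type*} [AddCommMonoid M] (A : Finset ℕ) (n : ℕ) (f : ℕ × ℕ → M) :
    ∑ p ∈ ivls A n, f p = ∑ a ∈ A, f (a, n) :=
  Finset.sum_image fun _ _ _ _ h => congrArg Prod.fst h

theorem SepColl.card_biUnion_ivls {A : Finset ℕ} {n : ℕ} (h : SepColl (ivls A n))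
    (hn : 1 ≤ n) : ((ivls A n).biUnion ivl).card = A.card * n := by
  rw [h.card_biUnion_ivl fun p hp => (mem_ivls.1 hp).2 ▸ hn, sum_ivls]
  simp

/-- The members of `A` that are left endpoints of intervals of length `n` contained in `q`. -/
def inside (A : Finset ℕ) (n : ℕ) (q : ℕ × ℕ) : Finset ℕ :=
  A.filter fun a => q.1 ≤ a ∧ a + n - 1 ≤ q.1 + q.2 - 1

/-- The members of `A` that are left endpoints of intervals of length `n` separated from `U`. -/
noncomputable def away (A : Finset ℕ) (n : ℕ) (U : Finset (ℕ × ℕ)) : Finset ℕ :=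
  A.filter fun a => ∀ q ∈ U, SepPair (a, n) q

theorem card_inside_mul_le {A : Finset ℕ} {n : ℕ} (hA : SepColl (ivls A n)) (hn : 1 ≤ n)
    {q : ℕ × ℕ} (hq : 1 ≤ q.2) : (inside A n q).card * n ≤ q.2 := by
  have hs : SepColl (ivls (inside A n q) n) := hA.mono (ivls_mono (Finset.filter_subset _ _) n)
  have h := hs.sum_length_le (a := q.1) (b := q.1 + q.2 - 1)
    (fun p hp => (mem_ivls.1 hp).2 ▸ hn) fun p hp => by
      obtain ⟨h1, h2⟩ := mem_ivls.1 hp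
      rw [h2]
      exact (Finset.mem_filter.1 h1).2
  rw [sum_ivls] at h
  simp only [Finset.sum_const, smul_eq_mul] at h
  omega

theorem sum_card_inside_add_card_away_le {A : Finset ℕ} {n : ℕ} {U : Finset (ℕ × ℕ)}
    (hn : 1 ≤ n) (hU : SepColl U) (hU1 : ∀ q ∈ U, 1 ≤ q.2) :
    ∑ q ∈ U, (inside A n q).card + (away A n U).card ≤ A.card := by
  have h1 : (U.biUnion (inside A n)).card = ∑ q ∈ U, (inside A n q).card := by
    refine Finset.card_biUnion fun p hp q hq hpq => ?_
    rw [Function.onFun, Finset.disjoint_left]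
    intro a ha hb
    have ha := (Finset.mem_filter.1 ha).2
    have hb := (Finset.mem_filter.1 hb).2
    have := hU1 p hp
    have := hU1 q hq
    rcases hU p hp q hq hpq with h | h <;> omega
  rw [← h1, ← Finset.card_union_of_disjoint]
  · refine Finset.card_le_card (Finset.union_subset (Finset.biUnion_subset.2 fun q _ => ?_) ?_)
    · exact Finset.filter_subset _ _
    · exact Finset.filter_subset _ _
  · rw [Finset.disjoint_left]
    intro a ha hb
    obtain ⟨q, hq, ha⟩ := Finset.mem_biUnion.1 ha
    have ha := (Finset.mem_filter.1 ha).2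
    have := hU1 q hq
    rcases (Finset.mem_filter.1 hb).2 q hq with h | h <;> simp only at h <;> omega

theorem card_le_card_away_add (A : Finset ℕ) (n : ℕ) (U : Finset (ℕ × ℕ)) :
    A.card ≤ (away A n U).card + ∑ q ∈ U, ((inside A n q).card + 2 * n) := by
  let S : ℕ × ℕ → Finset ℕ := fun q =>
    inside A n q ∪ (Finset.Ico (q.1 - n) q.1 ∪ Finset.Icc (q.1 + q.2 + 1 - n) (q.1 + q.2))
  have hsub : A ⊆ away A n U ∪ U.biUnion S := by
    intro a ha
    by_cases h : ∀ q ∈ U, SepPair (a, n) q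
    · exact Finset.mem_union_left _ (Finset.mem_filter.2 ⟨ha, h⟩)
    · push Not at h
      obtain ⟨q, hq, h⟩ := h
      refine Finset.mem_union_right _ (Finset.mem_biUnion.2 ⟨q, hq, ?_⟩)
      simp only [SepPair, not_or, not_lt] at h
      simp only [S, inside, Finset.mem_union, Finset.mem_filter, Finset.mem_Ico,
        Finset.mem_Icc, ha, true_and]
      omega
  have hS : ∀ q, (S q).card ≤ (inside A n q).card + 2 * n := by
    intro q
    refine (Finset.card_union_le _ _).trans (Nat.add_le_add_left ?_ _)
    refine (Finset.card_union_le _ _).trans ?_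
    rw [Nat.card_Ico, Nat.card_Icc]
    omega
  calc A.card ≤ (away A n U ∪ U.biUnion S).card := Finset.card_le_card hsub
    _ ≤ (away A n U).card + (U.biUnion S).card := Finset.card_union_le _ _
    _ ≤ _ := Nat.add_le_add_left
        (Finset.card_biUnion_le.trans (Finset.sum_le_sum fun q _ => hS q)) _

/-- `q` is `(lam, eps)`-separately covered by the intervals of length `n` with left endpoints
in `A` that it contains. -/
def IsCovered (A : Finset ℕ) (n : ℕ) (lam eps : ℝ) (q : ℕ × ℕ) : Prop :=
  SepCovOn (ivls (inside A n q) n) q.1 (q.1 + q.2 - 1) lam eps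

theorem abs_card_inside_mul_sub_le {A : Finset ℕ} {n : ℕ} {lam eps : ℝ}
    (hA : SepColl (ivls A n)) (hn : 1 ≤ n) (heps : 0 < eps) (hlam : 0 < lam ∧ lam < 1)
    {q : ℕ × ℕ} (hq : 1 ≤ q.2) :
    |((inside A n q).card * n : ℝ) - lam * q.2| ≤
      eps * q.2 + if ¬ IsCovered A n lam eps q then (q.2 : ℝ) else 0 := by
  have hq0 : (0 : ℝ) < q.2 := by exact_mod_cast hq
  by_cases h : ¬ IsCovered A n lam eps q
  · rw [if_pos h]
    have h1 : ((inside A n q).card * n : ℝ) ≤ q.2 := by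
      exact_mod_cast card_inside_mul_le hA hn hq
    have h2 : (0 : ℝ) ≤ (inside A n q).card * n := by positivity
    rw [abs_le]
    constructor <;> nlinarith
  · rw [if_neg h]
    obtain ⟨hs, -, h⟩ := not_not.1 h
    rw [hs.card_biUnion_ivls hn, show q.1 + q.2 - 1 - q.1 + 1 = q.2 by omega] at h
    have : ((inside A n q).card * n : ℝ) - lam * q.2 =
        (((inside A n q).card * n : ℕ) / (q.2 : ℝ) - lam) * q.2 := by
      push_cast
      field_simp
    rw [this, abs_mul, abs_of_pos hq0, add_zero]
    exact mul_le_mul_of_nonneg_right h.le hq0.le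

theorem abs_card_away_mul_sub_le {A : Finset ℕ} {n : ℕ} {U : Finset (ℕ × ℕ)}
    {lam eps D β : ℝ} (hA : SepColl (ivls A n)) (hn : 1 ≤ n) (heps : 0 < eps)
    (hlam : 0 < lam ∧ lam < 1) (hU : SepColl U) (hU1 : ∀ q ∈ U, 1 ≤ q.2)
    (hAD : |(A.card * n : ℝ) - lam * D| ≤ eps * D) (hUD : ∑ q ∈ U, (q.2 : ℝ) ≤ D)
    (hβ : (∑ q ∈ U, if ¬ IsCovered A n lam eps q then (q.2 : ℝ) else 0) ≤ β) :
    |((away A n U).card * n : ℝ) - lam * (D - ∑ q ∈ U, (q.2 : ℝ))| ≤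
      2 * eps * D + β + 2 * n ^ 2 * U.card := by
  have h1 : |∑ q ∈ U, ((inside A n q).card * n : ℝ) - lam * ∑ q ∈ U, (q.2 : ℝ)| ≤
      eps * D + β := by
    rw [Finset.mul_sum, ← Finset.sum_sub_distrib]
    calc _ ≤ ∑ q ∈ U, |((inside A n q).card * n : ℝ) - lam * q.2| :=
          Finset.abs_sum_le_sum_abs _ _
      _ ≤ ∑ q ∈ U, (eps * q.2 + if ¬ IsCovered A n lam eps q then (q.2 : ℝ) else 0) :=
          Finset.sum_le_sum fun q hq => abs_card_inside_mul_sub_le hA hn heps hlam (hU1 q hq)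
      _ ≤ eps * D + β := by
          rw [Finset.sum_add_distrib, ← Finset.mul_sum]
          exact add_le_add (mul_le_mul_of_nonneg_left hUD heps.le) hβ
  have h2 : ∑ q ∈ U, ((inside A n q).card * n : ℝ) + (away A n U).card * n ≤ A.card * n := by
    rw [← Finset.sum_mul, ← add_mul]
    refine mul_le_mul_of_nonneg_right ?_ n.cast_nonneg
    exact_mod_cast sum_card_inside_add_card_away_le hn hU hU1
  have h3 : (A.card * n : ℝ) ≤
      (away A n U).card * n + ∑ q ∈ U, ((inside A n q).card * n : ℝ) + 2 * n ^ 2 * U.card := by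
    have h : (A.card : ℝ) ≤
        (away A n U).card + (∑ q ∈ U, ((inside A n q).card : ℝ) + U.card * (2 * n)) := by
      have := card_le_card_away_add A n U
      rw [Finset.sum_add_distrib, Finset.sum_const, smul_eq_mul] at this
      exact_mod_cast this
    rw [← Finset.sum_mul]
    nlinarith [mul_le_mul_of_nonneg_right h n.cast_nonneg]
  rw [abs_le] at h1 hAD ⊢
  constructor <;> nlinarith

/-- The family of all intervals of length `N j` with left endpoints in `A j`. -/
def allIvls {l : ℕ} (A : Fin l → Finset ℕ) (N : Fin l → ℕ) : Finset (ℕ × ℕ) :=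
  Finset.univ.biUnion fun j => ivls (A j) (N j)

theorem mem_allIvls {l : ℕ} {A : Fin l → Finset ℕ} {N : Fin l → ℕ} {p : ℕ × ℕ} :
    p ∈ allIvls A N ↔ ∃ j, p.1 ∈ A j ∧ p.2 = N j := by
  simp [allIvls, mem_ivls]

theorem sum_allIvls {M : Type*} [AddCommMonoid M] {l : ℕ} (A : Fin l → Finset ℕ)
    {N : Fin l → ℕ} (hN : Function.Injective N) (f : ℕ × ℕ → M) :
    ∑ p ∈ allIvls A N, f p = ∑ j, ∑ a ∈ A j, f (a, N j) := by
  rw [allIvls, Finset.sum_biUnion]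
  · simp only [sum_ivls]
  · intro i _ j _ hij
    rw [Function.onFun, Finset.disjoint_left]
    intro p hp hq
    exact hij (hN ((mem_ivls.1 hp).2.symm.trans (mem_ivls.1 hq).2))

theorem allIvls_cons {l : ℕ} (B : Finset ℕ) (A : Fin l → Finset ℕ) (N : Fin (l + 1) → ℕ) :
    allIvls (Fin.cons B A) N = ivls B (N 0) ∪ allIvls A fun j => N j.succ := by
  ext p
  simp [mem_allIvls, mem_ivls, Fin.exists_fin_succ]

/-- The contribution of the scale `r` to the covering error. -/
noncomputable def scaleErr {l : ℕ} (r : Fin l) (N : Fin l → ℕ) (η : Fin l → ℝ) : ℝ :=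
  ∑ i, if i < r then η r * N r + 2 * (N i : ℝ) ^ 2 / N r else 0

theorem scaleErr_nonneg {l : ℕ} (r : Fin l) (N : Fin l → ℕ) {η : Fin l → ℝ}
    (hη : ∀ i, 0 < η i) : 0 ≤ scaleErr r N η := by
  refine Finset.sum_nonneg fun i _ => ?_
  have := hη r
  split_ifs <;> positivity

theorem scaleErr_congr {l : ℕ} {r : Fin l} {N N' : Fin l → ℕ} {η η' : Fin l → ℝ}
    (hN : ∀ i ≤ r, N i = N' i) (hη : η r = η' r) : scaleErr r N η = scaleErr r N' η' := by
  refine Finset.sum_congr rfl fun i _ => ?_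
  split_ifs with h
  · rw [hN i h.le, hN r le_rfl, hη]
  · rfl

theorem sum_scaleErr_succ {l : ℕ} (N : Fin (l + 1) → ℕ) (η : Fin (l + 1) → ℝ) :
    ∑ r, scaleErr r N η =
      ∑ r : Fin l, (η r.succ * N r.succ + 2 * (N 0 : ℝ) ^ 2 / N r.succ) +
        ∑ r : Fin l, scaleErr r (fun j => N j.succ) fun j => η j.succ := by
  rw [Fin.sum_univ_succ, ← Finset.sum_add_distrib]
  have h0 : scaleErr 0 N η = 0 := by simp [scaleErr]
  rw [h0, zero_add]
  refine Finset.sum_congr rfl fun r _ => ?_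
  simp [scaleErr, Fin.sum_univ_succ]

theorem exists_separated_subfamily {K : ℕ} {ε : ℝ} (hε : 0 < ε) (l : ℕ) (N : Fin l → ℕ)
    (η : Fin l → ℝ) (lam : Fin l → ℝ) (A : Fin l → Finset ℕ) (hη : ∀ j, 0 < η j)
    (hN1 : ∀ j, 1 ≤ N j) (hN : StrictMono N) (hlam : ∀ j, 0 < lam j ∧ lam j < 1)
    (hA : ∀ j, SepCovOn (ivls (A j) (N j)) 1 K (lam j) ε)
    (hbad : ∀ j r : Fin l, j < r →
      (((Finset.Icc 1 (K + 1 - N r)).filter fun s =>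
        ¬ IsCovered (A j) (N j) (lam j) ε (s, N r)).card : ℝ) < η r * K) :
    ∃ A' : Fin l → Finset ℕ, (∀ j, A' j ⊆ A j) ∧ SepColl (allIvls A' N) ∧
      |∑ p ∈ allIvls A' N, (p.2 : ℝ) - (1 - ∏ j, (1 - lam j)) * (K - 1 + 1 : ℕ)| ≤
        (2 * l * ε + ∑ r, scaleErr r N η) * (K - 1 + 1 : ℕ) := by
  induction l with
  | zero => exact ⟨A, fun _ => subset_rfl, by simp [allIvls, SepColl], by simp [allIvls]⟩
  | succ l ih =>
    obtain ⟨A', hA', hsep, herr⟩ := ih (fun j => N j.succ) (fun j => η j.succ)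
      (fun j => lam j.succ) (fun j => A j.succ) (fun j => hη _) (fun j => hN1 _)
      (fun i j hij => hN (Fin.succ_lt_succ_iff.2 hij)) (fun j => hlam _) (fun j => hA _)
      (fun j r hjr => hbad _ _ (Fin.succ_lt_succ_iff.2 hjr))
    have hinj : Function.Injective fun j : Fin l => N j.succ :=
      fun i j hij => Fin.succ_injective _ (hN.injective hij)
    set U := allIvls A' fun j => N j.succ with hUdef
    set D : ℝ := ((K - 1 + 1 : ℕ) : ℝ) with hD
    have hDpos : 0 < D := by positivity
    have hKD : (K : ℝ) ≤ D := by
      rw [hD]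
      exact_mod_cast (by omega : K ≤ K - 1 + 1)
    have hU1 : ∀ q ∈ U, 1 ≤ q.2 := by
      intro q hq
      obtain ⟨j, -, h⟩ := mem_allIvls.1 hq
      exact h ▸ hN1 _
    have hUmem : ∀ q ∈ U, 1 ≤ q.1 ∧ q.1 + q.2 - 1 ≤ K := by
      intro q hq
      obtain ⟨j, h, h'⟩ := mem_allIvls.1 hq
      exact (hA j.succ).2.1 q (mem_ivls.2 ⟨hA' j h, h'⟩)
    have hUD : ∑ q ∈ U, (q.2 : ℝ) ≤ D := by
      refine le_trans ?_ hKD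
      have := hsep.sum_length_le hU1 hUmem
      rw [Nat.add_sub_cancel] at this
      exact_mod_cast this
    have hA0 : |((A 0).card * N 0 : ℝ) - lam 0 * D| ≤ ε * D := by
      obtain ⟨hs, -, h⟩ := hA 0
      rw [hs.card_biUnion_ivls (hN1 0)] at h
      have : ((A 0).card * N 0 : ℝ) - lam 0 * D =
          (((A 0).card * N 0 : ℕ) / D - lam 0) * D := by
        push_cast
        field_simp
      rw [this, abs_mul, abs_of_pos hDpos]
      exact mul_le_mul_of_nonneg_right h.le hDpos.le
    have hβ : (∑ q ∈ U, if ¬ IsCovered (A 0) (N 0) (lam 0) ε q then (q.2 : ℝ) else 0) ≤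
        ∑ r : Fin l, η r.succ * N r.succ * D := by
      rw [hUdef, sum_allIvls _ hinj]
      refine Finset.sum_le_sum fun r _ => ?_
      simp only [← Finset.sum_filter, Finset.sum_const, nsmul_eq_mul]
      have hsub : (A' r).filter (fun a => ¬ IsCovered (A 0) (N 0) (lam 0) ε (a, N r.succ)) ⊆
          (Finset.Icc 1 (K + 1 - N r.succ)).filter fun s =>
            ¬ IsCovered (A 0) (N 0) (lam 0) ε (s, N r.succ) := by
        refine Finset.filter_subset_filter _ fun a ha => ?_
        have h := (hA r.succ).2.1 (a, N r.succ) (mem_ivls.2 ⟨hA' r ha, rfl⟩)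
        have := hN1 r.succ
        simp only at h
        rw [Finset.mem_Icc]
        omega
      have hcard : (((A' r).filter
          (fun a => ¬ IsCovered (A 0) (N 0) (lam 0) ε (a, N r.succ))).card : ℝ) ≤
          η r.succ * D :=
        (Nat.cast_le.2 (Finset.card_le_card hsub)).trans
          ((hbad 0 r.succ (Fin.succ_pos r)).le.trans
            (mul_le_mul_of_nonneg_left hKD (hη _).le))
      calc _ ≤ η r.succ * D * N r.succ :=
            mul_le_mul_of_nonneg_right hcard (Nat.cast_nonneg _)
        _ = _ := by ring
    have hcardU : 2 * (N 0 : ℝ) ^ 2 * U.card ≤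
        ∑ r : Fin l, 2 * (N 0 : ℝ) ^ 2 / N r.succ * D := by
      have : (U.card : ℝ) = ∑ r : Fin l, ((A' r).card : ℝ) := by
        rw [Finset.cast_card, hUdef, sum_allIvls _ hinj]
        simp
      rw [this, Finset.mul_sum]
      refine Finset.sum_le_sum fun r _ => ?_
      rw [div_mul_eq_mul_div, mul_div_assoc]
      refine mul_le_mul_of_nonneg_left ?_ (by positivity)
      rw [le_div_iff₀ (by exact_mod_cast hN1 r.succ)]
      refine le_trans ?_ hKD
      have h := ((hA r.succ).1.mono (ivls_mono (hA' r) _)).sum_length_le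
        (fun p hp => (mem_ivls.1 hp).2 ▸ hN1 _)
        fun p hp => (hA r.succ).2.1 p (ivls_mono (hA' r) _ hp)
      rw [sum_ivls, Finset.sum_const, smul_eq_mul, Nat.add_sub_cancel] at h
      exact_mod_cast h
    have hstep := abs_card_away_mul_sub_le (hA 0).1 (hN1 0) hε (hlam 0) hsep hU1 hA0 hUD hβ
    have hB : ∀ p ∈ ivls (away (A 0) (N 0) U) (N 0), ∀ q ∈ U, SepPair p q := by
      rintro ⟨a, m⟩ hp q hq
      obtain ⟨h1, rfl⟩ := mem_ivls.1 hp
      exact (Finset.mem_filter.1 h1).2 q hq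
    have hBA : away (A 0) (N 0) U ⊆ A 0 := Finset.filter_subset _ _
    refine ⟨Fin.cons (away (A 0) (N 0) U) A', Fin.cases hBA hA', ?_, ?_⟩
    · rw [allIvls_cons]
      exact ((hA 0).1.mono (ivls_mono hBA _)).union hsep hB
    · have hdisj : Disjoint (ivls (away (A 0) (N 0) U) (N 0)) U :=
        Finset.disjoint_left.2 fun p hp hq => not_sepPair_self p (hB p hp p hq)
      rw [allIvls_cons, ← hUdef, Finset.sum_union hdisj, sum_ivls, Fin.prod_univ_succ, sum_scaleErr_succ, Finset.sum_add_distrib]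
      simp only [Finset.sum_const, nsmul_eq_mul]
      rw [← Finset.sum_mul] at hstep hcardU
      set P := ∏ j : Fin l, (1 - lam j.succ)
      set u := ∑ q ∈ U, (q.2 : ℝ)
      set w : ℝ := (away (A 0) (N 0) U).card * N 0
      have hcontr : |(1 - lam 0) * (u - (1 - P) * D)| ≤ |u - (1 - P) * D| := by
        rw [abs_mul, abs_of_pos (by linarith [(hlam 0).2])]
        exact mul_le_of_le_one_left (abs_nonneg _) (by linarith [(hlam 0).1])
      have heq : w + u - (1 - (1 - lam 0) * P) * D =
          (w - lam 0 * (D - u)) + (1 - lam 0) * (u - (1 - P) * D) := by ring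
      rw [heq]
      refine (abs_add_le _ _).trans ((add_le_add hstep (hcontr.trans herr)).trans ?_)
      push_cast
      linarith

theorem exists_forall_scaleErr_update_lt {l : ℕ} (j : Fin l) (N : Fin l → ℕ) (η : Fin l → ℝ)
    {δ : ℝ} (hδ : 0 < δ) : ∃ M : ℕ, ∀ n, M ≤ n → ∃ e : ℝ, 0 < e ∧ ∀ h, 0 < h → h < e →
      scaleErr j (Function.update N j n) (Function.update η j h) < δ := by
  have hval : ∀ (n : ℕ) (h : ℝ),
      scaleErr j (Function.update N j n) (Function.update η j h) =
        ∑ i, if i < j then h * n + 2 * (N i : ℝ) ^ 2 / n else 0 := by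
    intro n h
    refine Finset.sum_congr rfl fun i _ => ?_
    split_ifs with hij
    · simp [Function.update_of_ne hij.ne]
    · rfl
  simp only [hval]
  have hlim : Tendsto (fun n : ℕ => ∑ i, if i < j then (0 : ℝ) * n + 2 * (N i : ℝ) ^ 2 / n else 0)
      atTop (𝓝 0) := by
    suffices h : ∀ i, Tendsto
        (fun n : ℕ => if i < j then (0 : ℝ) * n + 2 * (N i : ℝ) ^ 2 / n else 0) atTop (𝓝 0) by
      simpa only [Finset.sum_const_zero] using tendsto_finsetSum Finset.univ fun i _ => h i
    intro i
    split_ifs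
    · simpa using tendsto_const_div_atTop_nhds_zero_nat (2 * (N i : ℝ) ^ 2)
    · exact tendsto_const_nhds
  obtain ⟨M, hM⟩ := eventually_atTop.1 (hlim.eventually_lt_const hδ)
  refine ⟨M, fun n hn => ?_⟩
  have hcont : Continuous fun h : ℝ =>
      ∑ i, if i < j then h * n + 2 * (N i : ℝ) ^ 2 / n else 0 := by
    refine continuous_finsetSum _ fun i _ => ?_
    split_ifs <;> fun_prop
  obtain ⟨e, he, h⟩ := Metric.eventually_nhds_iff.1
    (hcont.continuousAt.eventually_lt_const (hM n hn))
  refine ⟨e, he, fun x hx hxe => h ?_⟩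
  rwa [Real.dist_eq, sub_zero, abs_of_pos hx]

theorem limsupChain_of_scaleErr_lt {l : ℕ} {ψ : (Fin l → ℕ) → (Fin l → ℝ) → ℝ} {c δ : ℝ}
    (hδ : 0 < δ) (hψ : ∀ N η, (∀ r, scaleErr r N η < δ) → ψ N η < c) (L : List (Fin l)) :
    ∀ (N : Fin l → ℕ) (η : Fin l → ℝ), L.Pairwise (· < ·) →
      (∀ r, r ∉ L → (∀ s ∈ L, r < s) ∧ scaleErr r N η < δ) → LimsupChain ψ c L N η := by
  induction L with
  | nil => exact fun N η _ h => hψ N η fun r => (h r List.not_mem_nil).2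
  | cons j L ih =>
    intro N η hL h
    obtain ⟨M, hM⟩ := exists_forall_scaleErr_update_lt j N η hδ
    refine ⟨M, fun n hn => ?_⟩
    obtain ⟨e, he, hlt⟩ := hM n hn
    refine ⟨e, he, fun x hx hxe => ih _ _ hL.of_cons fun r hr => ?_⟩
    rcases eq_or_ne r j with rfl | hrj
    · exact ⟨(List.pairwise_cons.1 hL).1, hlt x hx hxe⟩
    · obtain ⟨h1, h2⟩ := h r (by simp [hrj, hr])
      have hrj' : r < j := h1 j List.mem_cons_self
      refine ⟨fun s hs => h1 s (List.mem_cons_of_mem _ hs), ?_⟩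
      rwa [scaleErr_congr (N' := N) (η' := η)
        (fun i hi => Function.update_of_ne (hi.trans_lt hrj').ne _ _)
        (Function.update_of_ne hrj _ _)]

/-- **combinatorial covering lemma.** For every `l ≥ 1` there is a
positive function `φ(N₁,…,N_l, η₁,…,η_l, ε)` whose iterated limsup
`limsup_{ε→0} limsup_{N₁→∞} limsup_{η₁→0} ⋯ limsup_{N_l→∞} limsup_{η_l→0} φ`
vanishes, such that whenever separated collections `{I_i^j}_{i ∈ A_j}` of
subintervals of `[1, K]` of respective lengths `N₁ < ⋯ < N_l` satisfy
conditions (a), (b), (c), one may extract subsets `A'_j ⊆ A_j` so that the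
combined collection is separated and is a
`(1 − ν₁(λ⃗), φ(N, η, ε))`-separated cover of `[1, K]`.
(Collections of intervals of fixed length `N j` are encoded by the finite set
`A j` of their left endpoints.) -/
theorem combinatorial_cover_lemma (l : ℕ) (hl : 1 ≤ l) :
    ∃ φ : (Fin l → ℕ) → (Fin l → ℝ) → ℝ → ℝ,
      (∀ N η ε, (∀ i, 0 < η i) → 0 < ε → 0 < φ N η ε) ∧
      (∀ c : ℝ, 0 < c → ∃ e₀ : ℝ, 0 < e₀ ∧ ∀ ε : ℝ, 0 < ε → ε < e₀ →
        ∀ N₀ : Fin l → ℕ, ∀ η₀ : Fin l → ℝ,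
          LimsupChain (fun N η => φ N η ε) c (List.finRange l) N₀ η₀) ∧
      (∀ (K : ℕ) (N : Fin l → ℕ) (η : Fin l → ℝ) (ε : ℝ) (lam : Fin l → ℝ)
          (A : Fin l → Finset ℕ),
        0 < ε → (∀ j, 0 < η j) → (∀ j, 1 ≤ N j) → StrictMono N →
        (∀ j, 0 < lam j ∧ lam j < 1) →
        -- (a) + (b): each collection is a `(λ_j, ε)`-separated cover of `[1, K]`
        -- consisting of intervals of length `N j`
        (∀ j, SepCovOn ((A j).image fun a => (a, N j)) 1 K (lam j) ε) →
        -- (c): for `j < r`, fewer than `η_r·K` subintervals `J` of `[1, K]` of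
        -- length `N r` fail to be `(λ_j, ε)`-separately covered by the members
        -- of the `j`-th collection contained in `J`
        (∀ j r : Fin l, j < r →
          (((Finset.Icc 1 (K + 1 - N r)).filter fun s =>
              ¬ SepCovOn (((A j).filter fun a => s ≤ a ∧ a + N j - 1 ≤ s + N r - 1).image
                fun a => (a, N j)) s (s + N r - 1) (lam j) ε).card : ℝ) < η r * K) →
        ∃ A' : Fin l → Finset ℕ, (∀ j, A' j ⊆ A j) ∧
          SepCovOn (Finset.univ.biUnion fun j : Fin l => (A' j).image fun a => (a, N j))
            1 K (1 - ∏ j : Fin l, (1 - lam j)) (φ N η ε)) := by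
  have hl0 : (0 : ℝ) < l := by exact_mod_cast hl
  refine ⟨fun N η ε => 2 * l * ε + ∑ r, scaleErr r N η + ε, ?_, ?_, ?_⟩
  · intro N η ε hη hε
    have : 0 ≤ ∑ r, scaleErr r N η := Finset.sum_nonneg fun r _ => scaleErr_nonneg r N hη
    positivity
  · intro c hc
    refine ⟨c / (2 * (2 * l + 1)), by positivity, fun ε hε hεc N₀ η₀ => ?_⟩
    rw [lt_div_iff₀ (by positivity)] at hεc
    refine limsupChain_of_scaleErr_lt (δ := c / (2 * l)) (by positivity) ?_ _ _ _
      (List.pairwise_lt_finRange l) fun r hr => absurd (List.mem_finRange r) hr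
    intro N η h
    have hsum : ∑ r, scaleErr r N η ≤ c / 2 := by
      calc _ ≤ ∑ _r : Fin l, c / (2 * l) := Finset.sum_le_sum fun r _ => (h r).le
        _ = c / 2 := by
          rw [Finset.sum_const, Finset.card_univ, Fintype.card_fin, nsmul_eq_mul]
          field_simp
    linarith
  · intro K N η ε lam A hε hη hN1 hN hlam hA hbad
    obtain ⟨A', hA', hsep, herr⟩ :=
      exists_separated_subfamily hε l N η lam A hη hN1 hN hlam hA hbad
    refine ⟨A', hA', hsep, fun p hp => ?_, ?_⟩
    · obtain ⟨j, h, h'⟩ := mem_allIvls.1 hp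
      exact (hA j).2.1 p (mem_ivls.2 ⟨hA' j h, h'⟩)
    · change |(((allIvls A' N).biUnion ivl).card : ℝ) / _ - _| < _
      rw [hsep.card_biUnion_ivl fun p hp => by
        obtain ⟨j, -, h⟩ := mem_allIvls.1 hp
        exact h ▸ hN1 j]
      have hD : (0 : ℝ) < (K - 1 + 1 : ℕ) := by positivity
      rw [Nat.cast_sum]
      rw [div_sub' hD.ne', abs_div, abs_of_pos hD, div_lt_iff₀ hD]
      rw [mul_comm _ (1 - _)]
      refine herr.trans_lt (mul_lt_mul_of_pos_right ?_ hD)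
      linarith
end
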